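/- arXiv:1108.1312 — 2 statements merged into one kernel-verified Lean document; each statement's English description precedes it below -/
import Mathlib

section
/- Let N ≥ 1 be an integer. There exists a constant C > 0, depending only on N, such that for every R > 0 and every function z that is twice continuously differentiable on an open set containing the closed annulus {x ∈ ℝ^N : R/4 ≤ |x| ≤ 2R}, one has ∫_{R/2 < |x| < R} |∇z(x)| dx ≤ C R ∫_{R/4 < |x| < 2R} |Δz(x)| dx + C R^{−1} ∫_{R/4 < |x| < 2R} |z(x)| dx. -/
open MeasureTheory Metric Set Filter

/-- The Euclidean Laplacian of `u : ℝ^N → ℝ`, as the sum of the second derivatives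
along the standard coordinate directions. -/
noncomputable def lap {N : ℕ} (u : EuclideanSpace ℝ (Fin N) → ℝ)
    (x : EuclideanSpace ℝ (Fin N)) : ℝ :=
  ∑ i : Fin N, iteratedFDeriv ℝ 2 u x ![EuclideanSpace.single i 1, EuclideanSpace.single i 1]

/-- `(u, v)` is a positive solution of the Hardy–Hénon system
`-Δu = |x|^a v^p`, `-Δv = |x|^b u^q` on the set `Ω`:
`u, v` are continuous on `Ω`, `C²` on `Ω \ {0}`, positive on `Ω`, and
the equations hold on `Ω \ {0}`. -/
def IsHHSol {N : ℕ} (a b p q : ℝ) (Ω : Set (EuclideanSpace ℝ (Fin N)))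
    (u v : EuclideanSpace ℝ (Fin N) → ℝ) : Prop :=
  ContinuousOn u Ω ∧ ContinuousOn v Ω ∧
  ContDiffOn ℝ 2 u (Ω \ {0}) ∧ ContDiffOn ℝ 2 v (Ω \ {0}) ∧
  (∀ x ∈ Ω, 0 < u x) ∧ (∀ x ∈ Ω, 0 < v x) ∧
  (∀ x ∈ Ω \ {0}, -lap u x = ‖x‖ ^ a * v x ^ p) ∧
  (∀ x ∈ Ω \ {0}, -lap v x = ‖x‖ ^ b * u x ^ q)

open scoped RealInnerProductSpace Topology

section Kernel

variable {E : Type*} [NormedAddCommGroup E]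

/-- A smooth radial bump function supported in the closed unit ball. -/
noncomputable def radialBump (y : E) : ℝ := expNegInvGlue (1 - ‖y‖ ^ 2)

theorem radialBump_eq_zero {y : E} (hy : 1 < ‖y‖) : radialBump y = 0 :=
  expNegInvGlue.zero_of_nonpos (by nlinarith)

variable [InnerProductSpace ℝ E]

theorem contDiff_radialBump : ContDiff ℝ 1 (radialBump : E → ℝ) :=
  (expNegInvGlue.contDiff (n := 1)).comp (contDiff_const.sub (contDiff_norm_sq ℝ))

theorem hasCompactSupport_radialBump [FiniteDimensional ℝ E] :
    HasCompactSupport (radialBump : E → ℝ) := by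
  refine HasCompactSupport.intro (isCompact_closedBall 0 1) fun y hy => radialBump_eq_zero ?_
  simpa using hy

theorem integral_radialBump_pos [FiniteDimensional ℝ E] [MeasurableSpace E] [BorelSpace E]
    {μ : Measure E} [μ.IsAddHaarMeasure] : 0 < ∫ y : E, radialBump y ∂μ := by
  refine contDiff_radialBump.continuous.integral_pos_of_hasCompactSupport_nonneg_nonzero
    hasCompactSupport_radialBump (fun y => expNegInvGlue.nonneg _) (x := 0) ?_
  simp [radialBump]

theorem inner_mul_fderiv_radialBump_comm (y a b : E) :
    ⟪y, a⟫ * fderiv ℝ radialBump y b = ⟪y, b⟫ * fderiv ℝ radialBump y a := by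
  have h1 : HasFDerivAt (fun y : E => 1 - ‖y‖ ^ 2) (-(2 • innerSL ℝ y)) y :=
    (hasStrictFDerivAt_norm_sq y).hasFDerivAt.const_sub 1
  have h2 : HasDerivAt expNegInvGlue (deriv expNegInvGlue (1 - ‖y‖ ^ 2)) (1 - ‖y‖ ^ 2) :=
    ((expNegInvGlue.contDiff (n := 1)).differentiable one_ne_zero _).hasDerivAt
  have h3 : HasFDerivAt (radialBump : E → ℝ) _ y := h2.comp_hasFDerivAt y h1
  rw [h3.fderiv]
  simp
  ring

variable [MeasurableSpace E] [BorelSpace E] {μ : Measure E} [μ.IsAddHaarMeasure]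

/-- Differentiation under the integral sign for averages at scale `t`. -/
theorem hasDerivAt_integral_mul_comp_sub_smul {φ h : E → ℝ} (hφ : Continuous φ)
    (hφc : HasCompactSupport φ) (hh : ContDiff ℝ 1 h) (hhc : HasCompactSupport h) (x : E) (t : ℝ) :
    HasDerivAt (fun t : ℝ => ∫ y, φ y * h (x - t • y) ∂μ)
      (∫ y, φ y * fderiv ℝ h (x - t • y) (-y) ∂μ) t := by
  have hcf := hh.continuous_fderiv one_ne_zero
  obtain ⟨M, hM⟩ := hcf.bounded_above_of_compact_support (hhc.fderiv ℝ)
  have hcont : ∀ t : ℝ, Continuous fun y => φ y * h (x - t • y) := fun t =>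
    hφ.mul (hh.continuous.comp (by fun_prop))
  have hcont' : ∀ t : ℝ, Continuous fun y => φ y * fderiv ℝ h (x - t • y) (-y) := fun t =>
    hφ.mul ((hcf.comp (by fun_prop)).clm_apply (by fun_prop))
  refine (hasDerivAt_integral_of_dominated_loc_of_deriv_le (s := univ)
    (F := fun t y => φ y * h (x - t • y)) (F' := fun t y => φ y * fderiv ℝ h (x - t • y) (-y))
    (bound := fun y => ‖φ y‖ * (M * ‖y‖)) Filter.univ_mem
    (Eventually.of_forall fun t => (hcont t).aestronglyMeasurable)
    ((hcont t).integrable_of_hasCompactSupport hφc.mul_right)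
    (hcont' t).aestronglyMeasurable
    (Eventually.of_forall fun y t _ => ?_) ?_ (Eventually.of_forall fun y t _ => ?_)).2
  · rw [norm_mul]
    gcongr
    refine (ContinuousLinearMap.le_opNorm _ _).trans ?_
    rw [norm_neg]
    gcongr
    exact hM _
  · exact Continuous.integrable_of_hasCompactSupport (by fun_prop) hφc.norm.mul_right
  · have h1 : HasDerivAt (fun t : ℝ => x - t • y) (-y) t := by
      simpa using ((hasDerivAt_id t).smul_const y).const_sub x
    exact (((hh.differentiable one_ne_zero _).hasFDerivAt).comp_hasDerivAt t h1).const_mul (φ y)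

variable [FiniteDimensional ℝ E]

/-- Integrating by parts against a radial kernel exchanges the two directions. -/
theorem integral_inner_mul_fderiv_comm {φ V : E → ℝ} (hφ : ContDiff ℝ 1 φ)
    (hφc : HasCompactSupport φ)
    (hrad : ∀ y a b : E, ⟪y, a⟫ * fderiv ℝ φ y b = ⟪y, b⟫ * fderiv ℝ φ y a)
    (hV : ContDiff ℝ 1 V) (a b : E) :
    ∫ y, ⟪y, a⟫ * φ y * fderiv ℝ V y b ∂μ = ∫ y, ⟪y, b⟫ * φ y * fderiv ℝ V y a ∂μ := by
  have hd : ∀ a b y : E, fderiv ℝ (fun y => ⟪y, a⟫ * φ y) y b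
      = ⟪b, a⟫ * φ y + ⟪y, a⟫ * fderiv ℝ φ y b := by
    intro a b y
    have h1 : HasFDerivAt (fun y : E => ⟪y, a⟫) (innerSL ℝ a) y := by
      simpa [real_inner_comm] using! (innerSL ℝ a).hasFDerivAt (x := y)
    rw [show (fun y : E => ⟪y, a⟫ * φ y) = (fun y => ⟪y, a⟫) * φ from rfl,
      (h1.mul (hφ.differentiable one_ne_zero y).hasFDerivAt).fderiv]
    simp [real_inner_comm]
    ring
  have hc : ∀ a : E, ContDiff ℝ 1 (fun y => ⟪y, a⟫ * φ y) := fun a =>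
    (contDiff_id.inner ℝ contDiff_const).mul hφ
  have hs : ∀ a : E, HasCompactSupport (fun y => ⟪y, a⟫ * φ y) := fun a => hφc.mul_left
  have ibp : ∀ a b : E, ∫ y, ⟪y, a⟫ * φ y * fderiv ℝ V y b ∂μ
      = - ∫ y, (⟪b, a⟫ * φ y + ⟪y, a⟫ * fderiv ℝ φ y b) * V y ∂μ := by
    intro a b
    have hVb : Continuous fun y => fderiv ℝ V y b :=
      (hV.continuous_fderiv one_ne_zero).clm_apply continuous_const
    have hfb : Continuous fun y => fderiv ℝ (fun y => ⟪y, a⟫ * φ y) y b :=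
      ((hc a).continuous_fderiv one_ne_zero).clm_apply continuous_const
    rw [integral_mul_fderiv_eq_neg_fderiv_mul_of_integrable]
    · simp_rw [hd]
    · exact (hfb.mul hV.continuous).integrable_of_hasCompactSupport
        ((hs a).fderiv_apply ℝ b).mul_right
    · exact ((hc a).continuous.mul hVb).integrable_of_hasCompactSupport (hs a).mul_right
    · exact ((hc a).continuous.mul hV.continuous).integrable_of_hasCompactSupport
        (hs a).mul_right
    · exact fun x _ => (hc a).differentiable one_ne_zero x
    · exact fun x _ => hV.differentiable one_ne_zero x
  rw [ibp a b, ibp b a]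
  simp_rw [hrad _ a b, real_inner_comm a b]

/-- Moving a derivative from a rescaled function onto the kernel. -/
theorem integral_mul_fderiv_comp_sub_smul {φ w : E → ℝ} (hφ : ContDiff ℝ 1 φ)
    (hφc : HasCompactSupport φ) (hw : ContDiff ℝ 1 w) (v x : E) {s : ℝ} (hs : s ≠ 0) :
    ∫ y, φ y * fderiv ℝ w (x - s • y) v ∂μ = s⁻¹ * ∫ y, fderiv ℝ φ y v * w (x - s • y) ∂μ := by
  have hV : ContDiff ℝ 1 fun y => w (x - s • y) := hw.comp (by fun_prop)
  have hd : ∀ y, fderiv ℝ (fun y => w (x - s • y)) y v = - s * fderiv ℝ w (x - s • y) v := by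
    intro y
    have h1 : HasFDerivAt (fun y : E => x - s • y) (-(s • ContinuousLinearMap.id ℝ E)) y :=
      ((hasFDerivAt_id y).const_smul s).const_sub x
    have h2 := ((hw.differentiable one_ne_zero (x - s • y)).hasFDerivAt).comp y h1
    rw [show (fun y => w (x - s • y)) = w ∘ fun y => x - s • y from rfl, h2.fderiv]
    simp
  have hVb : Continuous fun y => fderiv ℝ (fun y => w (x - s • y)) y v :=
    (hV.continuous_fderiv one_ne_zero).clm_apply continuous_const
  have hfb : Continuous fun y => fderiv ℝ φ y v :=
    (hφ.continuous_fderiv one_ne_zero).clm_apply continuous_const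
  have ibp := integral_mul_fderiv_eq_neg_fderiv_mul_of_integrable (μ := μ) (f := φ)
    (g := fun y => w (x - s • y)) (v := v)
    ((hfb.mul hV.continuous).integrable_of_hasCompactSupport (hφc.fderiv_apply ℝ v).mul_right)
    ((hφ.continuous.mul hVb).integrable_of_hasCompactSupport hφc.mul_right)
    ((hφ.continuous.mul hV.continuous).integrable_of_hasCompactSupport hφc.mul_right)
    (fun x _ => hφ.differentiable one_ne_zero x) (fun x _ => hV.differentiable one_ne_zero x)
  simp_rw [hd] at ibp
  have e : ∫ y, φ y * (-s * fderiv ℝ w (x - s • y) v) ∂μ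
      = -s * ∫ y, φ y * fderiv ℝ w (x - s • y) v ∂μ := by
    rw [← integral_const_mul]
    congr 1 with y
    ring
  rw [e] at ibp
  field_simp
  linarith

end Kernel

section Estimate

theorem lap_eq_sum_fderiv {N : ℕ} {w : EuclideanSpace ℝ (Fin N) → ℝ} (hw : ContDiff ℝ 2 w)
    (x : EuclideanSpace ℝ (Fin N)) :
    lap w x = ∑ i : Fin N, fderiv ℝ (fun p => fderiv ℝ w p (EuclideanSpace.single i 1)) x
      (EuclideanSpace.single i 1) := by
  have hd : DifferentiableAt ℝ (fderiv ℝ w) x :=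
    (hw.fderiv_right (m := 1) (by norm_num)).differentiable one_ne_zero x
  refine Finset.sum_congr rfl fun i _ => ?_
  rw [iteratedFDeriv_two_apply, fderiv_clm_apply hd (by fun_prop)]
  simp

theorem continuous_lap {N : ℕ} {w : EuclideanSpace ℝ (Fin N) → ℝ} (hw : ContDiff ℝ 2 w) :
    Continuous (lap w) := by
  unfold lap
  refine continuous_finsetSum _ fun i _ => ?_
  exact (ContinuousMultilinearMap.apply ℝ (fun _ : Fin 2 => EuclideanSpace ℝ (Fin N)) ℝ
    ![EuclideanSpace.single i 1, EuclideanSpace.single i 1]).continuous.comp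
    (hw.continuous_iteratedFDeriv le_rfl)

theorem HasCompactSupport.lap {N : ℕ} {w : EuclideanSpace ℝ (Fin N) → ℝ}
    (hw : HasCompactSupport w) : HasCompactSupport (lap w) := by
  refine (hw.iteratedFDeriv (𝕜 := ℝ) 2).mono fun x hx => ?_
  contrapose! hx
  simp only [Function.mem_support, not_not] at hx ⊢
  simp [_root_.lap, hx]

variable {N : ℕ}

local notation "𝔼" => EuclideanSpace ℝ (Fin N)

/-- For a radial kernel, the scale derivative of the average of a directional derivative of `w`
only involves the Laplacian of `w`. -/
theorem integral_mul_fderiv_fderiv_eq_integral_lap {φ w : 𝔼 → ℝ} (hφ : ContDiff ℝ 1 φ)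
    (hφc : HasCompactSupport φ)
    (hrad : ∀ y a b : 𝔼, ⟪y, a⟫ * fderiv ℝ φ y b = ⟪y, b⟫ * fderiv ℝ φ y a)
    (hw : ContDiff ℝ 2 w) (v x : 𝔼) {t : ℝ} (ht : t ≠ 0) :
    ∫ y, φ y * fderiv ℝ (fun p => fderiv ℝ w p v) (x - t • y) (-y)
      = -∫ y, ⟪y, v⟫ * φ y * lap w (x - t • y) := by
  have hw1 : ContDiff ℝ 1 (fderiv ℝ w) := hw.fderiv_right (by norm_num)
  have hD : ∀ a b p : 𝔼, fderiv ℝ (fun p => fderiv ℝ w p a) p b = fderiv ℝ (fderiv ℝ w) p b a := by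
    intro a b p
    rw [fderiv_clm_apply (hw1.differentiable one_ne_zero p) (by fun_prop)]
    simp
  have hsymm : ∀ a b p : 𝔼, fderiv ℝ (fderiv ℝ w) p a b = fderiv ℝ (fderiv ℝ w) p b a :=
    fun a b p => hw.contDiffAt.isSymmSndFDerivAt (by simp) a b
  have hC : ∀ a b : 𝔼, Continuous fun y => fderiv ℝ (fderiv ℝ w) (x - t • y) a b := fun a b =>
    (((hw1.continuous_fderiv one_ne_zero).comp (by fun_prop)).clm_apply
      continuous_const).clm_apply continuous_const
  have hint : ∀ a b c : 𝔼, Integrable fun y =>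
      ⟪y, c⟫ * φ y * fderiv ℝ (fderiv ℝ w) (x - t • y) a b := fun a b c =>
    (((continuous_id.inner continuous_const).mul hφ.continuous).mul
      (hC a b)).integrable_of_hasCompactSupport hφc.mul_left.mul_right
  have key : ∀ a : 𝔼, ∫ y, ⟪y, a⟫ * φ y * fderiv ℝ (fderiv ℝ w) (x - t • y) v a
      = ∫ y, ⟪y, v⟫ * φ y * fderiv ℝ (fderiv ℝ w) (x - t • y) a a := by
    intro a
    have hV : ContDiff ℝ 1 fun y => fderiv ℝ w (x - t • y) a :=
      (hw1.comp (by fun_prop)).clm_apply contDiff_const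
    have hdV : ∀ b y, fderiv ℝ (fun y => fderiv ℝ w (x - t • y) a) y b
        = -t * fderiv ℝ (fderiv ℝ w) (x - t • y) b a := by
      intro b y
      have h1 : HasFDerivAt (fun y : 𝔼 => x - t • y) (-(t • ContinuousLinearMap.id ℝ 𝔼)) y :=
        ((hasFDerivAt_id y).const_smul t).const_sub x
      have h2 := ((hw1.clm_apply (contDiff_const (c := a))).differentiable one_ne_zero
        (x - t • y)).hasFDerivAt.comp y h1
      rw [show (fun y => fderiv ℝ w (x - t • y) a)
        = (fun p => fderiv ℝ w p a) ∘ fun y => x - t • y from rfl, h2.fderiv]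
      simp [hD]
    have h := integral_inner_mul_fderiv_comm (μ := volume) hφ hφc hrad hV a v
    simp_rw [hdV, mul_left_comm _ (-t), integral_const_mul] at h
    exact mul_left_cancel₀ (neg_ne_zero.2 ht) h
  simp_rw [lap_eq_sum_fderiv hw, hD, Finset.mul_sum]
  rw [integral_finsetSum _ fun i _ => hint _ _ _]
  simp_rw [← key]
  rw [← integral_finsetSum _ fun i _ => hint _ _ _, ← integral_neg]
  congr 1 with y
  have hy : y = ∑ i : Fin N, ⟪y, EuclideanSpace.single i 1⟫ • EuclideanSpace.single i (1 : ℝ) := by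
    have := (EuclideanSpace.basisFun (Fin N) ℝ).sum_repr' y
    simpa [real_inner_comm] using this.symm
  have hexp : fderiv ℝ (fderiv ℝ w) (x - t • y) v y = ∑ i : Fin N, ⟪y, EuclideanSpace.single i 1⟫
      * fderiv ℝ (fderiv ℝ w) (x - t • y) v (EuclideanSpace.single i 1) := by
    conv_lhs => rw [hy]
    rw [map_sum]
    simp only [map_smul, smul_eq_mul]
    simp only [← hy]
  rw [map_neg, neg_apply, hsymm y v, hexp, mul_neg, Finset.mul_sum]
  congr 1
  exact Finset.sum_congr rfl fun i _ => by ring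

/-- Pointwise bound for a directional derivative by averages of the function and its Laplacian. -/
theorem enorm_fderiv_mul_enorm_integral_le {φ w : 𝔼 → ℝ} (hφ : ContDiff ℝ 1 φ)
    (hφc : HasCompactSupport φ)
    (hrad : ∀ y a b : 𝔼, ⟪y, a⟫ * fderiv ℝ φ y b = ⟪y, b⟫ * fderiv ℝ φ y a)
    (hw : ContDiff ℝ 2 w) (hwc : HasCompactSupport w) (v x : 𝔼) {s : ℝ} (hs : 0 < s) :
    ‖fderiv ℝ w x v‖ₑ * ‖∫ y, φ y‖ₑ
      ≤ ‖s⁻¹‖ₑ * (∫⁻ y, ‖fderiv ℝ φ y v‖ₑ * ‖w (x - s • y)‖ₑ)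
        + ∫⁻ t in Ioc 0 s, ∫⁻ y, ‖⟪y, v⟫ * φ y‖ₑ * ‖lap w (x - t • y)‖ₑ := by
  have hh : ContDiff ℝ 1 fun p => fderiv ℝ w p v :=
    (hw.fderiv_right (by norm_num)).clm_apply contDiff_const
  have hhc : HasCompactSupport fun p => fderiv ℝ w p v := hwc.fderiv_apply ℝ v
  have hderiv := hasDerivAt_integral_mul_comp_sub_smul (μ := volume) hφ.continuous hφc hh hhc x
  have hcf := hh.continuous_fderiv one_ne_zero
  obtain ⟨M, hM⟩ := hcf.bounded_above_of_compact_support (hhc.fderiv ℝ)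
  have hcont : Continuous fun t : ℝ =>
      ∫ y, φ y * fderiv ℝ (fun p => fderiv ℝ w p v) (x - t • y) (-y) := by
    refine continuous_of_dominated (bound := fun y => ‖φ y‖ * (M * ‖y‖)) (fun t => ?_)
      (fun t => Eventually.of_forall fun y => ?_) ?_ (Eventually.of_forall fun y => ?_)
    · exact (hφ.continuous.mul ((hcf.comp (by fun_prop)).clm_apply
        (by fun_prop))).aestronglyMeasurable
    · rw [norm_mul]
      gcongr
      refine (ContinuousLinearMap.le_opNorm _ _).trans ?_
      rw [norm_neg]
      gcongr
      exact hM _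
    · exact (hφ.continuous.norm.mul (by fun_prop)).integrable_of_hasCompactSupport
        hφc.norm.mul_right
    · exact continuous_const.mul ((hcf.comp (by fun_prop)).clm_apply continuous_const)
  have hftc := intervalIntegral.integral_eq_sub_of_hasDerivAt (a := 0) (b := s)
    (fun t _ => hderiv t) (hcont.intervalIntegrable _ _)
  simp only [zero_smul, sub_zero, integral_mul_const] at hftc
  rw [integral_mul_fderiv_comp_sub_smul hφ hφc (hw.of_le (by norm_num)) v x hs.ne'] at hftc
  have heq : fderiv ℝ w x v * ∫ y, φ y = s⁻¹ * (∫ y, fderiv ℝ φ y v * w (x - s • y))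
      - ∫ t in (0 : ℝ)..s, ∫ y, φ y * fderiv ℝ (fun p => fderiv ℝ w p v) (x - t • y) (-y) := by
    linarith
  rw [← enorm_mul, heq]
  refine enorm_sub_le.trans ?_
  gcongr
  · rw [enorm_mul]
    gcongr
    refine (enorm_integral_le_lintegral_enorm _).trans_eq ?_
    simp_rw [enorm_mul]
  · rw [intervalIntegral.integral_of_le hs.le]
    refine (enorm_integral_le_lintegral_enorm _).trans ?_
    refine setLIntegral_mono' measurableSet_Ioc fun t ht => ?_
    rw [integral_mul_fderiv_fderiv_eq_integral_lap hφ hφc hrad hw v x ht.1.ne', enorm_neg]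
    refine (enorm_integral_le_lintegral_enorm _).trans_eq ?_
    simp_rw [enorm_mul]

/-- Averages at scale `t` are bounded in `L¹` by the `L¹` norms of kernel and function. -/
theorem setLIntegral_lintegral_mul_comp_sub_smul_le {k f : 𝔼 → ℝ} (hk : Continuous k)
    (hk1 : ∀ y, 1 < ‖y‖ → k y = 0) (hf : Continuous f) {A B : Set 𝔼} (hA : MeasurableSet A)
    (hB : MeasurableSet B) {t : ℝ} (hAB : ∀ x ∈ A, ∀ y : 𝔼, ‖y‖ ≤ 1 → x - t • y ∈ B) :
    ∫⁻ x in A, ∫⁻ y, ‖k y‖ₑ * ‖f (x - t • y)‖ₑ ≤ (∫⁻ y, ‖k y‖ₑ) * ∫⁻ x in B, ‖f x‖ₑ := by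
  have hmeas : Measurable (Function.uncurry fun x y : 𝔼 => ‖k y‖ₑ * ‖f (x - t • y)‖ₑ) := by
    refine Continuous.measurable ?_ |>.enorm.mul (Continuous.measurable ?_).enorm
    · exact hk.comp continuous_snd
    · exact hf.comp (by fun_prop)
  rw [lintegral_lintegral_swap hmeas.aemeasurable, ← lintegral_mul_const _ hk.measurable.enorm]
  refine lintegral_mono fun y => ?_
  rw [lintegral_const_mul' _ _ enorm_ne_top]
  by_cases hy : 1 < ‖y‖
  · simp [hk1 y hy]
  refine mul_le_mul' le_rfl ?_
  calc ∫⁻ x in A, ‖f (x - t • y)‖ₑ ≤ ∫⁻ x, B.indicator (fun x => ‖f x‖ₑ) (x - t • y) := by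
        rw [← lintegral_indicator hA]
        refine lintegral_mono fun x => ?_
        by_cases hx : x ∈ A
        · simp [hx, hAB x hx y (not_lt.1 hy)]
        · simp [hx]
    _ = ∫⁻ x in B, ‖f x‖ₑ := by
        rw [lintegral_sub_right_eq_self, lintegral_indicator hB]

/-- Interior `L¹` bound for a directional derivative in terms of the function and its Laplacian. -/
theorem setLIntegral_enorm_fderiv_mul_le {φ w : 𝔼 → ℝ} (hφ : ContDiff ℝ 1 φ)
    (hφ1 : ∀ y, 1 < ‖y‖ → φ y = 0)
    (hrad : ∀ y a b : 𝔼, ⟪y, a⟫ * fderiv ℝ φ y b = ⟪y, b⟫ * fderiv ℝ φ y a)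
    (hw : ContDiff ℝ 2 w) (hwc : HasCompactSupport w) (v : 𝔼) {s : ℝ} (hs : 0 < s)
    {A B : Set 𝔼} (hA : MeasurableSet A) (hB : MeasurableSet B)
    (hAB : ∀ x ∈ A, ∀ t ∈ Ioc 0 s, ∀ y : 𝔼, ‖y‖ ≤ 1 → x - t • y ∈ B) :
    (∫⁻ x in A, ‖fderiv ℝ w x v‖ₑ) * ‖∫ y, φ y‖ₑ
      ≤ ‖s⁻¹‖ₑ * ((∫⁻ y, ‖fderiv ℝ φ y v‖ₑ) * ∫⁻ x in B, ‖w x‖ₑ)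
        + (∫⁻ y, ‖⟪y, v⟫ * φ y‖ₑ) * (∫⁻ x in B, ‖lap w x‖ₑ) * ENNReal.ofReal s := by
  have hφc : HasCompactSupport φ :=
    HasCompactSupport.intro (isCompact_closedBall 0 1) fun y hy => hφ1 y (by simpa using hy)
  have hk1 : ∀ y : 𝔼, 1 < ‖y‖ → fderiv ℝ φ y v = 0 := by
    intro y hy
    have : φ =ᶠ[𝓝 y] fun _ => 0 :=
      (continuous_norm.continuousAt.eventually_const_lt hy).mono fun z hz => hφ1 z hz
    rw [this.fderiv_eq]
    simp
  have hk1c : Continuous fun y => fderiv ℝ φ y v :=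
    (hφ.continuous_fderiv one_ne_zero).clm_apply continuous_const
  have hk2c : Continuous fun y : 𝔼 => ⟪y, v⟫ * φ y :=
    (continuous_id.inner continuous_const).mul hφ.continuous
  have hlap := continuous_lap hw
  have hm : Measurable (Function.uncurry fun (x : 𝔼) (t : ℝ) =>
      ∫⁻ y, ‖⟪y, v⟫ * φ y‖ₑ * ‖lap w (x - t • y)‖ₑ) := by
    refine Measurable.lintegral_prod_right'
      (f := fun q : (𝔼 × ℝ) × 𝔼 => ‖⟪q.2, v⟫ * φ q.2‖ₑ * ‖lap w (q.1.1 - q.1.2 • q.2)‖ₑ) ?_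
    refine Continuous.measurable ?_ |>.enorm.mul (Continuous.measurable ?_).enorm
    · exact hk2c.comp continuous_snd
    · exact hlap.comp (by fun_prop)
  have hm1 : Measurable fun x : 𝔼 => ∫⁻ y, ‖fderiv ℝ φ y v‖ₑ * ‖w (x - s • y)‖ₑ := by
    refine Measurable.lintegral_prod_right'
      (f := fun q : 𝔼 × 𝔼 => ‖fderiv ℝ φ q.2 v‖ₑ * ‖w (q.1 - s • q.2)‖ₑ) ?_
    refine Continuous.measurable ?_ |>.enorm.mul (Continuous.measurable ?_).enorm
    · exact hk1c.comp continuous_snd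
    · exact hw.continuous.comp (by fun_prop)
  rw [← lintegral_mul_const' _ _ enorm_ne_top]
  refine (lintegral_mono fun x =>
    enorm_fderiv_mul_enorm_integral_le hφ hφc hrad hw hwc v x hs).trans ?_
  rw [lintegral_add_left (hm1.const_mul _), lintegral_const_mul' _ _ enorm_ne_top,
    lintegral_lintegral_swap hm.aemeasurable]
  gcongr
  · exact setLIntegral_lintegral_mul_comp_sub_smul_le hk1c hk1 hw.continuous hA hB
      fun x hx => hAB x hx s ⟨hs, le_rfl⟩
  · calc _ ≤ ∫⁻ t in Ioc 0 s, (∫⁻ y, ‖⟪y, v⟫ * φ y‖ₑ) * ∫⁻ x in B, ‖lap w x‖ₑ := by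
          refine setLIntegral_mono' measurableSet_Ioc fun t ht => ?_
          exact setLIntegral_lintegral_mul_comp_sub_smul_le hk2c
            (fun y hy => by simp [hφ1 y hy]) hlap hA hB fun x hx => hAB x hx t ht
      _ = _ := by simp

/-- Interior `L¹` bound for a directional derivative, in terms of real integrals. -/
theorem setIntegral_norm_fderiv_mul_le {φ w : 𝔼 → ℝ} (hφ : ContDiff ℝ 1 φ)
    (hφ1 : ∀ y, 1 < ‖y‖ → φ y = 0)
    (hrad : ∀ y a b : 𝔼, ⟪y, a⟫ * fderiv ℝ φ y b = ⟪y, b⟫ * fderiv ℝ φ y a)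
    (hw : ContDiff ℝ 2 w) (hwc : HasCompactSupport w) (v : 𝔼) {s : ℝ} (hs : 0 < s)
    {A B : Set 𝔼} (hA : MeasurableSet A) (hB : MeasurableSet B)
    (hAB : ∀ x ∈ A, ∀ t ∈ Ioc 0 s, ∀ y : 𝔼, ‖y‖ ≤ 1 → x - t • y ∈ B) :
    (∫ x in A, ‖fderiv ℝ w x v‖) * ‖∫ y, φ y‖
      ≤ s⁻¹ * ((∫ y, ‖fderiv ℝ φ y v‖) * ∫ x in B, ‖w x‖)
        + (∫ y, ‖⟪y, v⟫ * φ y‖) * (∫ x in B, ‖lap w x‖) * s := by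
  have hφc : HasCompactSupport φ :=
    HasCompactSupport.intro (isCompact_closedBall 0 1) fun y hy => hφ1 y (by simpa using hy)
  have i1 : Integrable fun x => fderiv ℝ w x v :=
    ((hw.continuous_fderiv two_ne_zero).clm_apply
      continuous_const).integrable_of_hasCompactSupport (hwc.fderiv_apply ℝ v)
  have i2 : Integrable fun y => fderiv ℝ φ y v :=
    ((hφ.continuous_fderiv one_ne_zero).clm_apply
      continuous_const).integrable_of_hasCompactSupport (hφc.fderiv_apply ℝ v)
  have i3 : Integrable w := hw.continuous.integrable_of_hasCompactSupport hwc
  have i4 : Integrable fun y : 𝔼 => ⟪y, v⟫ * φ y :=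
    ((continuous_id.inner continuous_const).mul
      hφ.continuous).integrable_of_hasCompactSupport hφc.mul_left
  have i5 : Integrable (lap w) := (continuous_lap hw).integrable_of_hasCompactSupport hwc.lap
  have h := setLIntegral_enorm_fderiv_mul_le hφ hφ1 hrad hw hwc v hs hA hB hAB
  rw [← ofReal_integral_norm_eq_lintegral_enorm i1.integrableOn,
    ← ofReal_integral_norm_eq_lintegral_enorm i2,
    ← ofReal_integral_norm_eq_lintegral_enorm i3.integrableOn,
    ← ofReal_integral_norm_eq_lintegral_enorm i4,
    ← ofReal_integral_norm_eq_lintegral_enorm i5.integrableOn, ← ofReal_norm, ← ofReal_norm,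
    ← ENNReal.ofReal_mul (by positivity), ← ENNReal.ofReal_mul (by positivity),
    ← ENNReal.ofReal_mul (by positivity), ← ENNReal.ofReal_mul (by positivity),
    ← ENNReal.ofReal_mul (by positivity), ← ENNReal.ofReal_add (by positivity) (by positivity),
    ENNReal.ofReal_le_ofReal_iff (by positivity), Real.norm_of_nonneg (inv_nonneg.2 hs.le)] at h
  exact h

/-- A function that is `C²` near a compact set agrees there with a compactly supported `C²`
function on the whole space. -/
theorem exists_contDiff_hasCompactSupport_eqOn {U K : Set 𝔼} {z : 𝔼 → ℝ} (hU : IsOpen U)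
    (hK : IsCompact K) (hKU : K ⊆ U) (hz : ContDiffOn ℝ 2 z U) :
    ∃ w : 𝔼 → ℝ, ContDiff ℝ 2 w ∧ HasCompactSupport w ∧ EqOn w z K := by
  obtain ⟨L, hL, hKL, hLU⟩ := exists_compact_between hK hU hKU
  obtain ⟨f, hf1, hf0, -⟩ := exists_contMDiffMap_one_nhds_of_subset_interior
    (n := 2) (modelWithCornersSelf ℝ 𝔼) hK.isClosed hKL
  have hf : ContDiff ℝ 2 f := f.contMDiff.contDiff
  refine ⟨fun x => f x * z x, contDiff_iff_contDiffAt.2 fun x => ?_,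
    HasCompactSupport.intro hL fun x hx => by simp [hf0 x hx], fun x hx => ?_⟩
  · by_cases hx : x ∈ U
    · exact hf.contDiffAt.mul (hz.contDiffAt (hU.mem_nhds hx))
    · have : (fun x => f x * z x) =ᶠ[𝓝 x] fun _ => 0 :=
        eventually_of_mem (hL.isClosed.isOpen_compl.mem_nhds fun h => hx (hLU h))
          fun y hy => by simp [hf0 y hy]
      exact contDiffAt_const.congr_of_eventuallyEq this
  · simp [hf1.self_of_nhdsSet x hx]

/-- The gradient is bounded by the sum of the partial derivatives. -/
theorem norm_gradient_le_sum (w : 𝔼 → ℝ) (x : 𝔼) :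
    ‖gradient w x‖ ≤ ∑ i : Fin N, ‖fderiv ℝ w x (EuclideanSpace.single i 1)‖ := by
  have h := (EuclideanSpace.basisFun (Fin N) ℝ).sum_repr' (gradient w x)
  conv_lhs => rw [← h]
  refine (norm_sum_le _ _).trans (Finset.sum_le_sum fun i _ => ?_)
  rw [norm_smul, real_inner_comm, gradient, InnerProductSpace.toDual_symm_apply]
  simp

end Estimate

/-- Lemma 2.3: interpolation inequality on an annulus. -/
theorem interpolation_inequality_annulus
    (N : ℕ) (hN : 1 ≤ N) :
    ∃ C > 0, ∀ R > (0 : ℝ), ∀ z : EuclideanSpace ℝ (Fin N) → ℝ,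
      (∃ U : Set (EuclideanSpace ℝ (Fin N)), IsOpen U ∧
        {x : EuclideanSpace ℝ (Fin N) | R / 4 ≤ ‖x‖ ∧ ‖x‖ ≤ 2 * R} ⊆ U ∧
        ContDiffOn ℝ 2 z U) →
      (∫ x in {x : EuclideanSpace ℝ (Fin N) | R / 2 < ‖x‖ ∧ ‖x‖ < R}, ‖gradient z x‖)
        ≤ C * R * (∫ x in {x : EuclideanSpace ℝ (Fin N) | R / 4 < ‖x‖ ∧ ‖x‖ < 2 * R}, |lap z x|)
          + C * R⁻¹ *
            ∫ x in {x : EuclideanSpace ℝ (Fin N) | R / 4 < ‖x‖ ∧ ‖x‖ < 2 * R}, |z x| := by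
  set φ : EuclideanSpace ℝ (Fin N) → ℝ := radialBump
  set c : ℝ := ‖∫ y, φ y‖
  have hc : 0 < c := norm_pos_iff.2 integral_radialBump_pos.ne'
  set K₁ : ℝ := ∑ i : Fin N, ∫ y, ‖fderiv ℝ φ y (EuclideanSpace.single i 1)‖ with hK₁
  set K₂ : ℝ := ∑ i : Fin N, ∫ y, ‖⟪y, EuclideanSpace.single i 1⟫ * φ y‖ with hK₂
  have hK₁0 : 0 ≤ K₁ := Finset.sum_nonneg fun i _ => integral_nonneg fun y => norm_nonneg _
  have hK₂0 : 0 ≤ K₂ := Finset.sum_nonneg fun i _ => integral_nonneg fun y => norm_nonneg _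
  refine ⟨(4 * K₁ + K₂) / c + 1, by positivity, ?_⟩
  rintro R hR z ⟨U, hU, hKU, hz⟩
  set A : Set (EuclideanSpace ℝ (Fin N)) := {x | R / 2 < ‖x‖ ∧ ‖x‖ < R}
  set B : Set (EuclideanSpace ℝ (Fin N)) := {x | R / 4 < ‖x‖ ∧ ‖x‖ < 2 * R}
  have hAo : IsOpen A :=
    (isOpen_lt continuous_const continuous_norm).inter (isOpen_lt continuous_norm continuous_const)
  have hBo : IsOpen B :=
    (isOpen_lt continuous_const continuous_norm).inter (isOpen_lt continuous_norm continuous_const)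
  have hK : IsCompact {x : EuclideanSpace ℝ (Fin N) | R / 4 ≤ ‖x‖ ∧ ‖x‖ ≤ 2 * R} := by
    refine (isCompact_closedBall 0 (2 * R)).of_isClosed_subset
      ((isClosed_le continuous_const continuous_norm).inter
        (isClosed_le continuous_norm continuous_const)) fun x hx => ?_
    simpa using hx.2
  obtain ⟨w, hw, hwc, hwz⟩ := exists_contDiff_hasCompactSupport_eqOn hU hK hKU hz
  have hBz : ∀ x ∈ B, z =ᶠ[𝓝 x] w := fun x hx =>
    eventually_of_mem (hBo.mem_nhds hx) fun y hy => (hwz ⟨hy.1.le, hy.2.le⟩).symm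
  have hAB : A ⊆ B := fun x hx => ⟨by linarith [hx.1], by linarith [hx.2]⟩
  have hgrad : ∫ x in A, ‖gradient z x‖ = ∫ x in A, ‖gradient w x‖ :=
    setIntegral_congr_fun hAo.measurableSet fun x hx => by
      simp only [gradient, (hBz x (hAB hx)).fderiv_eq]
  have hlap : ∫ x in B, |lap z x| = ∫ x in B, ‖lap w x‖ :=
    setIntegral_congr_fun hBo.measurableSet fun x hx => by
      simp only [lap, ((hBz x hx).iteratedFDeriv ℝ 2).eq_of_nhds, Real.norm_eq_abs]
  have hval : ∫ x in B, |z x| = ∫ x in B, ‖w x‖ :=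
    setIntegral_congr_fun hBo.measurableSet fun x hx => by
      simp only [(hBz x hx).eq_of_nhds, Real.norm_eq_abs]
  rw [hgrad, hlap, hval]
  have hshift : ∀ x ∈ A, ∀ t ∈ Ioc 0 (R / 4), ∀ y : EuclideanSpace ℝ (Fin N), ‖y‖ ≤ 1 →
      x - t • y ∈ B := by
    intro x hx t ht y hy
    have hty : ‖t • y‖ ≤ R / 4 := by
      rw [norm_smul, Real.norm_of_nonneg ht.1.le]
      nlinarith [ht.1, ht.2, norm_nonneg y]
    exact ⟨by linarith [hx.1, norm_sub_norm_le x (t • y)],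
      by linarith [hx.2, norm_sub_le x (t • y)]⟩
  have hDi : ∀ i : Fin N, IntegrableOn
      (fun x => ‖fderiv ℝ w x (EuclideanSpace.single i 1)‖) A := fun i =>
    (((hw.continuous_fderiv two_ne_zero).clm_apply
      continuous_const).integrable_of_hasCompactSupport
        (hwc.fderiv_apply ℝ _)).norm.integrableOn
  have hsum : ∫ x in A, ‖gradient w x‖
      ≤ ∑ i : Fin N, ∫ x in A, ‖fderiv ℝ w x (EuclideanSpace.single i 1)‖ := by
    rw [← integral_finsetSum _ fun i _ => hDi i]
    exact integral_mono_of_nonneg (Eventually.of_forall fun x => norm_nonneg _)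
      (integrable_finsetSum _ fun i _ => hDi i)
      (Eventually.of_forall fun x => norm_gradient_le_sum w x)
  set I := ∫ x in B, ‖lap w x‖
  set J := ∫ x in B, ‖w x‖
  have hI : 0 ≤ I := integral_nonneg fun x => norm_nonneg _
  have hJ : 0 ≤ J := integral_nonneg fun x => norm_nonneg _
  have hmain : (∫ x in A, ‖gradient w x‖) * c
      ≤ (R / 4)⁻¹ * (K₁ * J) + K₂ * I * (R / 4) := by
    refine (mul_le_mul_of_nonneg_right hsum hc.le).trans ?_
    rw [hK₁, hK₂]
    simp only [Finset.sum_mul, Finset.mul_sum]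
    rw [← Finset.sum_add_distrib]
    exact Finset.sum_le_sum fun i _ => setIntegral_norm_fderiv_mul_le contDiff_radialBump
      (fun y => radialBump_eq_zero) inner_mul_fderiv_radialBump_comm hw hwc _ (by positivity)
      hAo.measurableSet hBo.measurableSet hshift
  rw [← le_div_iff₀ hc] at hmain
  refine hmain.trans ?_
  have h1 : ((R / 4)⁻¹ * (K₁ * J) + K₂ * I * (R / 4)) / c
      = K₂ / 4 / c * (R * I) + 4 * K₁ / c * (R⁻¹ * J) := by
    field_simp
    ring
  rw [h1, mul_assoc, mul_assoc]
  have hK₁c : 0 ≤ K₁ / c := by positivity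
  have hK₂c : 0 ≤ K₂ / c := by positivity
  gcongr
  · linear_combination (3 / 4) * hK₂c + 4 * hK₁c
  · linear_combination hK₂c
end

section
/- Let N ≥ 3 be an integer, let a, b > −2 and p, q > 0 with pq > 1. Then there exists a constant C > 0, depending only on N, p, q, a, b, such that every positive solution (u, v) of the Hardy–Hénon system on ℝ^N satisfies, for all R > 0, the six estimates: ∫_{R/2<|x|<R} u dx ≤ C R^{N − α − (a+bp)/(pq−1)}, ∫_{R/2<|x|<R} v dx ≤ C R^{N − β − (b+aq)/(pq−1)}, ∫_{R/2<|x|<R} |∇u| dx ≤ C R^{N − 1 − α − (a+bp)/(pq−1)}, ∫_{R/2<|x|<R} |∇v| dx ≤ C R^{N − 1 − β − (b+aq)/(pq−1)}, ∫_{R/2<|x|<R} |Δu| dx ≤ C R^{N − 2 − α − (a+bp)/(pq−1)}, and ∫_{R/2<|x|<R} |Δv| dx ≤ C R^{N − 2 − β − (b+aq)/(pq−1)}. -/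
open MeasureTheory Metric Set Filter

/-- The partial derivative of `f` in the `i`-th coordinate direction. -/
noncomputable def pder {N : ℕ} (i : Fin N) (f : EuclideanSpace ℝ (Fin N) → ℝ)
    (x : EuclideanSpace ℝ (Fin N)) : ℝ :=
  fderiv ℝ f x (EuclideanSpace.single i 1)

section Calculus

variable {N : ℕ} {f g u : EuclideanSpace ℝ (Fin N) → ℝ} {x : EuclideanSpace ℝ (Fin N)}

lemma contDiffAt_pder (i : Fin N) (hf : ContDiffAt ℝ 2 f x) : ContDiffAt ℝ 1 (pder i f) x :=
  (hf.fderiv_right (m := 1) (by norm_num)).clm_apply contDiffAt_const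

lemma contDiff_pder (i : Fin N) (hf : ContDiff ℝ 2 f) : ContDiff ℝ 1 (pder i f) :=
  contDiff_iff_contDiffAt.2 fun _ => contDiffAt_pder i hf.contDiffAt

lemma lap_eq_sum_pder (hf : ContDiffAt ℝ 2 f x) : lap f x = ∑ i, pder i (pder i f) x := by
  unfold lap
  refine Finset.sum_congr rfl fun i _ => ?_
  rw [iteratedFDeriv_two_apply]
  have h : DifferentiableAt ℝ (fderiv ℝ f) x :=
    (hf.fderiv_right (m := 1) (by norm_num)).differentiableAt (by norm_num)
  have h2 := (h.hasFDerivAt.clm_apply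
    (hasFDerivAt_const (EuclideanSpace.single i (1 : ℝ)) x)).fderiv
  change _ = fderiv ℝ (fun y => fderiv ℝ f y (EuclideanSpace.single i 1)) x _
  rw [h2]
  simp

lemma sum_pder_sq (f : EuclideanSpace ℝ (Fin N) → ℝ) (x : EuclideanSpace ℝ (Fin N)) :
    ∑ i, pder i f x ^ 2 = ‖fderiv ℝ f x‖ ^ 2 := by
  have h : ∀ i, pder i f x = gradient f x i := fun i => by
    have := EuclideanSpace.inner_single_right (𝕜 := ℝ) i 1 (gradient f x)
    unfold pder
    rw [← toDual_gradient, InnerProductSpace.toDual_apply_apply, this]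
    simp
  rw [← toDual_gradient, LinearIsometryEquiv.norm_map, EuclideanSpace.norm_sq_eq]
  simp [h]

lemma pder_mul (i : Fin N) (hf : DifferentiableAt ℝ f x) (hg : DifferentiableAt ℝ g x) :
    pder i (fun y => f y * g y) x = f x * pder i g x + g x * pder i f x := by
  unfold pder
  rw [fderiv_fun_mul hf hg]
  simp

lemma eventually_differentiableAt (hf : ContDiffAt ℝ 2 f x) :
    ∀ᶠ y in nhds x, DifferentiableAt ℝ f y :=
  (hf.eventually (by simp)).mono fun _ h => h.differentiableAt (by norm_num)

lemma pder_congr (i : Fin N) (h : f =ᶠ[nhds x] g) : pder i f x = pder i g x := by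
  unfold pder
  rw [h.fderiv_eq]

lemma pder_add (i : Fin N) (hf : DifferentiableAt ℝ f x) (hg : DifferentiableAt ℝ g x) :
    pder i (fun y => f y + g y) x = pder i f x + pder i g x := by
  unfold pder
  rw [fderiv_fun_add hf hg]
  simp

lemma lap_mul (hf : ContDiffAt ℝ 2 f x) (hg : ContDiffAt ℝ 2 g x) :
    lap (fun y => f y * g y) x =
      f x * lap g x + g x * lap f x + 2 * ∑ i, pder i f x * pder i g x := by
  rw [lap_eq_sum_pder (hf.mul hg), lap_eq_sum_pder hf, lap_eq_sum_pder hg, Finset.mul_sum,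
    Finset.mul_sum, Finset.mul_sum, ← Finset.sum_add_distrib, ← Finset.sum_add_distrib]
  refine Finset.sum_congr rfl fun i _ => ?_
  have h : pder i (fun y => f y * g y) =ᶠ[nhds x]
      fun y => f y * pder i g y + g y * pder i f y := by
    filter_upwards [eventually_differentiableAt hf, eventually_differentiableAt hg] with y h1 h2
    exact pder_mul i h1 h2
  have hdf := hf.differentiableAt (by norm_num)
  have hdg := hg.differentiableAt (by norm_num)
  have hpf := (contDiffAt_pder i hf).differentiableAt (by norm_num)
  have hpg := (contDiffAt_pder i hg).differentiableAt (by norm_num)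
  rw [pder_congr i h, pder_add (f := fun y => f y * pder i g y)
    (g := fun y => g y * pder i f y) i (hdf.mul hpg) (hdg.mul hpf), pder_mul i hdf hpg,
    pder_mul i hdg hpf]
  ring

lemma pder_comp {h : ℝ → ℝ} {h' : ℝ} (i : Fin N) (hh : HasDerivAt h h' (f x))
    (hf : DifferentiableAt ℝ f x) : pder i (fun y => h (f y)) x = h' * pder i f x := by
  unfold pder
  have := (hh.comp_hasFDerivAt x hf.hasFDerivAt).fderiv
  rw [show (fun y => h (f y)) = h ∘ f from rfl, this]
  simp

lemma lap_comp {h h₁ : ℝ → ℝ} {h₂ : ℝ} (hf : ContDiffAt ℝ 2 f x) (hc : ContDiffAt ℝ 2 h (f x))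
    (hh : ∀ᶠ s in nhds (f x), HasDerivAt h (h₁ s) s) (hh₁ : HasDerivAt h₁ h₂ (f x)) :
    lap (fun y => h (f y)) x = h₁ (f x) * lap f x + h₂ * ‖fderiv ℝ f x‖ ^ 2 := by
  rw [← sum_pder_sq, lap_eq_sum_pder (f := fun y => h (f y)) (hc.comp x hf),
    lap_eq_sum_pder hf, Finset.mul_sum,
    Finset.mul_sum, ← Finset.sum_add_distrib]
  refine Finset.sum_congr rfl fun i _ => ?_
  have e : pder i (fun y => h (f y)) =ᶠ[nhds x] fun y => h₁ (f y) * pder i f y := by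
    filter_upwards [eventually_differentiableAt hf, hf.continuousAt.eventually hh] with y h1 h2
    exact pder_comp i h2 h1
  have hdf := hf.differentiableAt (by norm_num)
  have hpf := (contDiffAt_pder i hf).differentiableAt (by norm_num)
  rw [pder_congr i e, pder_mul (f := fun y => h₁ (f y)) i (hh₁.differentiableAt.comp x hdf) hpf,
    pder_comp i hh₁ hdf]
  ring

lemma pder_const_mul (i : Fin N) (c : ℝ) (hf : DifferentiableAt ℝ f x) :
    pder i (fun y => c * f y) x = c * pder i f x := by
  unfold pder
  rw [fderiv_const_mul hf]
  simp

lemma lap_const_mul (c : ℝ) (hf : ContDiffAt ℝ 2 f x) :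
    lap (fun y => c * f y) x = c * lap f x := by
  rw [lap_eq_sum_pder (contDiffAt_const.mul hf), lap_eq_sum_pder hf, Finset.mul_sum]
  refine Finset.sum_congr rfl fun i _ => ?_
  have h : pder i (fun y => c * f y) =ᶠ[nhds x] fun y => c * pder i f y := by
    filter_upwards [eventually_differentiableAt hf] with y h1
    exact pder_const_mul i c h1
  rw [pder_congr i h, pder_const_mul i c ((contDiffAt_pder i hf).differentiableAt (by norm_num))]

lemma lap_add (hf : ContDiffAt ℝ 2 f x) (hg : ContDiffAt ℝ 2 g x) :
    lap (fun y => f y + g y) x = lap f x + lap g x := by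
  rw [lap_eq_sum_pder (hf.add hg), lap_eq_sum_pder hf, lap_eq_sum_pder hg,
    ← Finset.sum_add_distrib]
  refine Finset.sum_congr rfl fun i _ => ?_
  have h : pder i (fun y => f y + g y) =ᶠ[nhds x] fun y => pder i f y + pder i g y := by
    filter_upwards [eventually_differentiableAt hf, eventually_differentiableAt hg] with y h1 h2
    exact pder_add i h1 h2
  rw [pder_congr i h, pder_add i ((contDiffAt_pder i hf).differentiableAt (by norm_num))
    ((contDiffAt_pder i hg).differentiableAt (by norm_num))]

lemma fderiv_comp_affine (R : ℝ) (z : EuclideanSpace ℝ (Fin N))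
    (hf : DifferentiableAt ℝ f (R • x + z)) :
    fderiv ℝ (fun y => f (R • y + z)) x = R • fderiv ℝ f (R • x + z) := by
  have h1 : HasFDerivAt (fun y : EuclideanSpace ℝ (Fin N) => R • y + z)
      (R • ContinuousLinearMap.id ℝ _) x := ((hasFDerivAt_id x).const_smul R).add_const z
  have h2 := (HasFDerivAt.comp x hf.hasFDerivAt h1).fderiv
  rw [show (fun y => f (R • y + z)) = f ∘ (fun y => R • y + z) from rfl, h2]
  ext v
  simp

lemma contDiffAt_comp_affine {n : WithTop ℕ∞} (R : ℝ) (z : EuclideanSpace ℝ (Fin N))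
    (hf : ContDiffAt ℝ n f (R • x + z)) : ContDiffAt ℝ n (fun y => f (R • y + z)) x :=
  ContDiffAt.comp x hf ((contDiffAt_id.const_smul R).add contDiffAt_const)

lemma lap_comp_affine (R : ℝ) (z : EuclideanSpace ℝ (Fin N))
    (hf : ContDiffAt ℝ 2 f (R • x + z)) :
    lap (fun y => f (R • y + z)) x = R ^ 2 * lap f (R • x + z) := by
  rw [lap_eq_sum_pder (contDiffAt_comp_affine R z hf), lap_eq_sum_pder hf, Finset.mul_sum]
  refine Finset.sum_congr rfl fun i _ => ?_
  have hc : ContinuousAt (fun y : EuclideanSpace ℝ (Fin N) => R • y + z) x := by fun_prop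
  have h : pder i (fun y => f (R • y + z)) =ᶠ[nhds x] fun y => R * pder i f (R • y + z) := by
    filter_upwards [hc.eventually (eventually_differentiableAt hf)] with y h1
    unfold pder
    rw [fderiv_comp_affine R z h1]
    simp
  have hp := contDiffAt_pder i hf
  rw [pder_congr i h, pder_const_mul i R
    ((contDiffAt_comp_affine R z hp).differentiableAt (by norm_num))]
  conv_lhs => unfold pder
  have := fderiv_comp_affine (f := pder i f) R z (hp.differentiableAt (by norm_num))
  change R * fderiv ℝ (fun y => pder i f (R • y + z)) x _ = _
  rw [this]
  change R * (R * pder i (pder i f) (R • x + z)) = _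
  ring

lemma fderiv_norm_sq_sub (z : EuclideanSpace ℝ (Fin N)) :
    ‖fderiv ℝ (fun y => ‖y - z‖ ^ 2) x‖ = 2 * ‖x - z‖ := by
  have h : HasFDerivAt (fun y : EuclideanSpace ℝ (Fin N) => ‖y - z‖ ^ 2)
      (2 • (innerSL ℝ (x - z))) x := by
    have := ((hasFDerivAt_id x).sub_const z).norm_sq
    simpa using this
  rw [h.fderiv, ← Nat.cast_smul_eq_nsmul ℝ, norm_smul, innerSL_apply_norm]
  norm_num

lemma contDiff_norm_sq_sub (z : EuclideanSpace ℝ (Fin N)) {n : WithTop ℕ∞} :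
    ContDiff ℝ n (fun y : EuclideanSpace ℝ (Fin N) => ‖y - z‖ ^ 2) :=
  (contDiff_id.sub contDiff_const).norm_sq ℝ

lemma lap_norm_sq_sub (z : EuclideanSpace ℝ (Fin N)) :
    lap (fun y => ‖y - z‖ ^ 2) x = 2 * N := by
  rw [lap_eq_sum_pder (contDiff_norm_sq_sub z).contDiffAt]
  have h : ∀ i : Fin N, pder i (fun y => ‖y - z‖ ^ 2) = fun y => 2 * (y i - z i) := by
    intro i
    ext y
    have h : HasFDerivAt (fun y : EuclideanSpace ℝ (Fin N) => ‖y - z‖ ^ 2)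
        (2 • (innerSL ℝ (y - z))) y := by
      have := ((hasFDerivAt_id y).sub_const z).norm_sq
      simpa using this
    unfold pder
    rw [h.fderiv]
    simp [EuclideanSpace.inner_single_right, two_mul]
  have h2 : ∀ i : Fin N, pder i (pder i (fun y => ‖y - z‖ ^ 2)) x = 2 := by
    intro i
    rw [h i]
    have h3 : HasFDerivAt (fun y : EuclideanSpace ℝ (Fin N) => 2 * (y i - z i))
        ((2 : ℝ) • (EuclideanSpace.proj i : EuclideanSpace ℝ (Fin N) →L[ℝ] ℝ)) x := by
      have := (((EuclideanSpace.proj i : EuclideanSpace ℝ (Fin N) →L[ℝ] ℝ).hasFDerivAt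
        (x := x)).sub_const (z i)).const_mul (2 : ℝ)
      simpa using this
    unfold pder
    rw [h3.fderiv]
    simp
  simp [h2, mul_comm]

end Calculus

section Green

variable {N : ℕ} {f g u ψ : EuclideanSpace ℝ (Fin N) → ℝ} {x : EuclideanSpace ℝ (Fin N)}

lemma tsupport_pder_subset (i : Fin N) : tsupport (pder i f) ⊆ tsupport f :=
  tsupport_fderiv_apply_subset ℝ _

lemma continuous_mul_of_zero_notMem_tsupport (hψ : ContinuousOn ψ {0}ᶜ) (h0 : (0 : _) ∉ tsupport ψ)
    (hg : ContinuousOn g {0}ᶜ) : Continuous (fun x => ψ x * g x) := by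
  refine continuous_of_tsupport fun x hx => ?_
  have hx' : x ∈ tsupport ψ := tsupport_mul_subset_left (g := g) hx
  have hx0 : x ∈ ({0}ᶜ : Set (EuclideanSpace ℝ (Fin N))) := by
    rintro rfl
    exact h0 hx'
  have hn := isOpen_compl_singleton.mem_nhds hx0
  exact (hψ.continuousAt hn).mul (hg.continuousAt hn)

lemma contDiffAt_of_punctured {n : WithTop ℕ∞} (hu : ContDiffOn ℝ n u {0}ᶜ) (hx : x ≠ 0) :
    ContDiffAt ℝ n u x :=
  hu.contDiffAt (isOpen_compl_singleton.mem_nhds hx)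

lemma continuousOn_pder (i : Fin N) (hu : ContDiffOn ℝ 2 u {0}ᶜ) :
    ContinuousOn (pder i u) {0}ᶜ := fun _ hx =>
  (contDiffAt_pder i (contDiffAt_of_punctured hu hx)).continuousAt.continuousWithinAt

lemma continuousOn_pder_pder (i : Fin N) (hu : ContDiffOn ℝ 2 u {0}ᶜ) :
    ContinuousOn (pder i (pder i u)) {0}ᶜ := fun _ hx =>
  (((contDiffAt_pder i (contDiffAt_of_punctured hu hx)).fderiv_right
    (m := 0) (by norm_num)).clm_apply contDiffAt_const).continuousAt.continuousWithinAt

lemma continuousOn_lap (hu : ContDiffOn ℝ 2 u {0}ᶜ) : ContinuousOn (lap u) {0}ᶜ :=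
  (continuousOn_finsetSum _ fun i _ => continuousOn_pder_pder i hu).congr
    fun _ hx => lap_eq_sum_pder (contDiffAt_of_punctured hu hx)

lemma continuous_lap_s13 (hu : ContDiff ℝ 2 u) : Continuous (lap u) := by
  have h : lap u = fun x => ∑ i, pder i (pder i u) x :=
    funext fun x => lap_eq_sum_pder hu.contDiffAt
  rw [h]
  exact continuous_finsetSum _ fun i _ =>
    ((contDiff_pder i hu).continuous_fderiv (by norm_num)).clm_apply continuous_const

lemma continuous_pder (i : Fin N) (hu : ContDiff ℝ 2 u) : Continuous (pder i u) :=
  (contDiff_pder i hu).continuous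

lemma tsupport_lap_subset (hψ : ContDiff ℝ 2 ψ) : tsupport (lap ψ) ⊆ tsupport ψ := by
  refine closure_minimal (fun x hx => ?_) (isClosed_tsupport _)
  rw [Function.mem_support, lap_eq_sum_pder hψ.contDiffAt] at hx
  obtain ⟨i, -, hi⟩ := Finset.exists_ne_zero_of_sum_ne_zero hx
  exact (tsupport_pder_subset i).trans (tsupport_pder_subset i) (subset_tsupport _ hi)

lemma hasCompactSupport_lap (hψ : ContDiff ℝ 2 ψ) (hc : HasCompactSupport ψ) :
    HasCompactSupport (lap ψ) :=
  hc.of_isClosed_subset (isClosed_tsupport _) (tsupport_lap_subset hψ)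

lemma hasCompactSupport_pder (i : Fin N) (hc : HasCompactSupport ψ) :
    HasCompactSupport (pder i ψ) :=
  hc.of_isClosed_subset (isClosed_tsupport _) (tsupport_pder_subset i)

lemma integral_mul_pder_eq_neg (i : Fin N) (hf : ContinuousOn f {0}ᶜ)
    (hf' : ContinuousOn (pder i f) {0}ᶜ)
    (hg : ContinuousOn g {0}ᶜ)
    (hgd : ∀ x ≠ 0, DifferentiableAt ℝ g x) (hg' : ContinuousOn (pder i g) {0}ᶜ)
    (hc : HasCompactSupport f) (h0 : (0 : _) ∉ tsupport f)
    (hfdiff : Differentiable ℝ f) :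
    ∫ x, f x * pder i g x = - ∫ x, pder i f x * g x := by
  have ne : ∀ x ∈ tsupport f, x ≠ 0 := by
    rintro x hx rfl
    exact h0 hx
  refine integral_mul_fderiv_eq_neg_fderiv_mul_of_integrable ?_ ?_ ?_
    (fun x _ => hfdiff x) (fun x hx => hgd x (ne x hx))
  · exact (continuous_mul_of_zero_notMem_tsupport hf'
      (fun h => h0 (tsupport_pder_subset i h)) hg).integrable_of_hasCompactSupport
        (hasCompactSupport_pder i hc).mul_right
  · exact (continuous_mul_of_zero_notMem_tsupport hf h0 hg').integrable_of_hasCompactSupport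
      hc.mul_right
  · exact (continuous_mul_of_zero_notMem_tsupport hf h0 hg).integrable_of_hasCompactSupport
      hc.mul_right

/-- Green's second identity for a compactly supported test function vanishing near the origin. -/
lemma integral_mul_lap_comm (hu : ContDiffOn ℝ 2 u {0}ᶜ) (hψ : ContDiff ℝ 2 ψ)
    (hc : HasCompactSupport ψ) (h0 : (0 : _) ∉ tsupport ψ) :
    ∫ x, ψ x * lap u x = ∫ x, u x * lap ψ x := by
  have ne : ∀ x ∈ tsupport ψ, x ≠ 0 := by
    rintro x hx rfl
    exact h0 hx
  have h0i : ∀ i, (0 : _) ∉ tsupport (pder i ψ) := fun i h => h0 (tsupport_pder_subset i h)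
  have h0ii : ∀ i, (0 : _) ∉ tsupport (pder i (pder i ψ)) :=
    fun i h => h0i i (tsupport_pder_subset i h)
  have hψ' := hψ.contDiffOn (s := ({0}ᶜ : Set _))
  have e1 : ∀ x, ψ x * lap u x = ∑ i, ψ x * pder i (pder i u) x := by
    intro x
    by_cases hx : x = 0
    · subst hx
      simp [image_eq_zero_of_notMem_tsupport h0]
    · rw [lap_eq_sum_pder (contDiffAt_of_punctured hu hx), Finset.mul_sum]
  have e2 : ∀ x, u x * lap ψ x = ∑ i, pder i (pder i ψ) x * u x := by
    intro x
    rw [lap_eq_sum_pder hψ.contDiffAt, Finset.mul_sum]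
    exact Finset.sum_congr rfl fun i _ => mul_comm _ _
  simp_rw [e1, e2]
  rw [integral_finsetSum, integral_finsetSum]
  · refine Finset.sum_congr rfl fun i _ => ?_
    have d1 : ∀ x ≠ 0, DifferentiableAt ℝ u x := fun x hx =>
      (contDiffAt_of_punctured hu hx).differentiableAt (by norm_num)
    have d2 : ∀ x ≠ 0, DifferentiableAt ℝ (pder i u) x := fun x hx =>
      (contDiffAt_pder i (contDiffAt_of_punctured hu hx)).differentiableAt (by norm_num)
    have d3 : Differentiable ℝ ψ := hψ.differentiable (by norm_num)
    have d4 : Differentiable ℝ (pder i ψ) := (contDiff_pder i hψ).differentiable (by norm_num)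
    rw [integral_mul_pder_eq_neg i hψ.continuous.continuousOn
        (continuousOn_pder i hψ') (continuousOn_pder i hu) d2
        (continuousOn_pder_pder i hu) hc h0 d3,
      integral_mul_pder_eq_neg i (continuousOn_pder i hψ')
        (continuousOn_pder_pder i hψ') hu.continuousOn d1 (continuousOn_pder i hu)
        (hasCompactSupport_pder i hc) (h0i i) d4, neg_neg]
  · intro i _
    exact (continuous_mul_of_zero_notMem_tsupport (continuousOn_pder_pder i hψ') (h0ii i)
      hu.continuousOn).integrable_of_hasCompactSupport
        (hasCompactSupport_pder i (hasCompactSupport_pder i hc)).mul_right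
  · intro i _
    exact (continuous_mul_of_zero_notMem_tsupport hψ.continuous.continuousOn h0
      (continuousOn_pder_pder i hu)).integrable_of_hasCompactSupport hc.mul_right

end Green

section Superharmonic

variable {N : ℕ} {u ψ : EuclideanSpace ℝ (Fin N) → ℝ}

lemma exists_abs_integral_mul_comp_smul_le {G k : EuclideanSpace ℝ (Fin N) → ℝ}
    (hG : Continuous G) (hGc : HasCompactSupport G) (hk : Continuous k)
    (hkc : HasCompactSupport k) :
    ∃ C, 0 ≤ C ∧ ∀ n : ℝ, 0 < n → |∫ x, G x * k (n • x)| ≤ C / n ^ N := by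
  obtain ⟨M, hM⟩ := hGc.exists_bound_of_continuous hG
  have hM0 : 0 ≤ M := (norm_nonneg _).trans (hM 0)
  refine ⟨M * ∫ x, ‖k x‖, mul_nonneg hM0 (integral_nonneg fun _ => norm_nonneg _),
    fun n hn => ?_⟩
  have hi : Integrable (fun x => ‖k (n • x)‖) :=
    ((hk.integrable_of_hasCompactSupport hkc).norm).comp_smul hn.ne'
  calc |∫ x, G x * k (n • x)| ≤ ∫ x, M * ‖k (n • x)‖ := by
        rw [← Real.norm_eq_abs]
        refine norm_integral_le_of_norm_le (hi.const_mul M) (ae_of_all _ fun x => ?_)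
        rw [norm_mul]
        exact mul_le_mul_of_nonneg_right (hM x) (norm_nonneg _)
    _ = M * (∫ x, ‖k x‖) / n ^ N := by
        rw [integral_const_mul, Measure.integral_comp_smul_of_nonneg volume (fun x => ‖k x‖) n
          (hR := hn.le), finrank_euclideanSpace_fin, smul_eq_mul]
        ring

/-- An isolated singularity of a continuous function that is superharmonic away from the origin
is removable in the sense of distributions. -/
lemma integral_mul_lap_nonpos (hN : 3 ≤ N) (hu : Continuous u) (hu2 : ContDiffOn ℝ 2 u {0}ᶜ)
    (hs : ∀ x ≠ 0, lap u x ≤ 0) (hψ : ContDiff ℝ 2 ψ) (hc : HasCompactSupport ψ)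
    (hψ0 : ∀ x, 0 ≤ ψ x) : ∫ x, u x * lap ψ x ≤ 0 := by
  let χ : ContDiffBump (0 : EuclideanSpace ℝ (Fin N)) := ⟨1, 2, by norm_num, by norm_num⟩
  have hχ : ContDiff ℝ 2 χ := χ.contDiff
  have hχc : HasCompactSupport χ := χ.hasCompactSupport
  have hi : ∀ {G k : EuclideanSpace ℝ (Fin N) → ℝ} {n : ℝ}, Continuous G → HasCompactSupport G →
      Continuous k → Integrable (fun x => G x * k (n • x)) := fun hG hGc hk =>
    (hG.mul (hk.comp (continuous_const_smul _))).integrable_of_hasCompactSupport hGc.mul_right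
  have c1 : Continuous fun x => u x * ψ x := hu.mul hψ.continuous
  have c2 : Continuous fun x => u x * lap ψ x := hu.mul (continuous_lap_s13 hψ)
  have c3 : ∀ i, Continuous fun x => u x * pder i ψ x := fun i => hu.mul (continuous_pder i hψ)
  have s1 : HasCompactSupport fun x => u x * ψ x := hc.mul_left
  have s2 : HasCompactSupport fun x => u x * lap ψ x := (hasCompactSupport_lap hψ hc).mul_left
  have s3 : ∀ i, HasCompactSupport fun x => u x * pder i ψ x :=
    fun i => (hasCompactSupport_pder i hc).mul_left
  obtain ⟨C₁, hC₁, h₁⟩ := exists_abs_integral_mul_comp_smul_le c1 s1 (continuous_lap_s13 hχ)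
    (hasCompactSupport_lap hχ hχc)
  obtain ⟨C₂, hC₂, h₂⟩ := exists_abs_integral_mul_comp_smul_le c2 s2 hχ.continuous hχc
  choose C₃ hC₃ h₃ using fun i => exists_abs_integral_mul_comp_smul_le (c3 i) (s3 i)
    (continuous_pder i hχ) (hasCompactSupport_pder i hχc)
  have key : ∀ n : ℝ, 1 ≤ n → ∫ x, u x * lap ψ x ≤ (C₁ + C₂ + 2 * ∑ i, C₃ i) * n⁻¹ := by
    intro n hn
    have hn0 : 0 < n := by linarith
    set χn : EuclideanSpace ℝ (Fin N) → ℝ := fun x => χ (n • x + 0) with hχn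
    have hχn2 : ContDiff ℝ 2 χn := contDiff_iff_contDiffAt.2 fun x =>
      contDiffAt_comp_affine n 0 hχ.contDiffAt
    have lχn : ∀ x, lap χn x = n ^ 2 * lap χ (n • x) := fun x => by
      rw [hχn, lap_comp_affine n 0 hχ.contDiffAt, add_zero]
    have pχn : ∀ i x, pder i χn x = n * pder i χ (n • x) := fun i x => by
      unfold pder
      rw [hχn, fderiv_comp_affine n 0 (hχ.differentiable (by norm_num) _), add_zero]
      simp
    have hprod : ContDiff ℝ 2 fun x => ψ x * χn x := hψ.mul hχn2
    set ψn : EuclideanSpace ℝ (Fin N) → ℝ := fun x => ψ x + (-1) * (ψ x * χn x) with hψn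
    have hψn2 : ContDiff ℝ 2 ψn := hψ.add (contDiff_const.mul hprod)
    have hψnc : HasCompactSupport ψn := hc.add (hc.mul_right.mul_left)
    have hψn0 : (0 : _) ∉ tsupport ψn := by
      rw [notMem_tsupport_iff_eventuallyEq]
      have : ball (0 : EuclideanSpace ℝ (Fin N)) n⁻¹ ∈ nhds 0 :=
        ball_mem_nhds _ (inv_pos.2 hn0)
      filter_upwards [this] with x hx
      have : χn x = 1 := by
        apply χ.one_of_mem_closedBall
        rw [mem_ball_zero_iff] at hx
        rw [add_zero, mem_closedBall_zero_iff, norm_smul, Real.norm_of_nonneg hn0.le]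
        calc n * ‖x‖ ≤ n * n⁻¹ := by gcongr
          _ = 1 := mul_inv_cancel₀ hn0.ne'
      simp [hψn, this]
    have hle : ∫ x, u x * lap ψn x ≤ 0 := by
      rw [← integral_mul_lap_comm hu2 hψn2 hψnc hψn0]
      refine integral_nonpos fun x => ?_
      by_cases hx : x = 0
      · subst hx
        simp [image_eq_zero_of_notMem_tsupport hψn0]
      · refine mul_nonpos_of_nonneg_of_nonpos ?_ (hs x hx)
        have : χn x ≤ 1 := χ.le_one
        simp only [hψn]
        nlinarith [hψ0 x]
    have hsplit : ∀ x, u x * lap ψ x = u x * lap ψn x + (n ^ 2 * ((u x * ψ x) * lap χ (n • x)) +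
        (u x * lap ψ x) * χ (n • x) +
        2 * (n * ∑ i, (u x * pder i ψ x) * pder i χ (n • x))) := by
      intro x
      rw [hψn, lap_add hψ.contDiffAt (contDiff_const.mul hprod).contDiffAt,
        lap_const_mul (f := fun x => ψ x * χn x) _ hprod.contDiffAt,
        lap_mul hψ.contDiffAt hχn2.contDiffAt, lχn]
      have : ∑ i, (u x * pder i ψ x) * pder i χ (n • x) * n
          = u x * ∑ i, pder i ψ x * pder i χn x := by
        rw [Finset.mul_sum]
        exact Finset.sum_congr rfl fun i _ => by rw [pχn]; ring
      rw [mul_comm n, Finset.sum_mul, this]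
      simp only [hχn, add_zero]
      ring
    have i0 : Integrable fun x => u x * lap ψn x :=
      (hu.mul (continuous_lap_s13 hψn2)).integrable_of_hasCompactSupport
        (hasCompactSupport_lap hψn2 hψnc).mul_left
    have i1 : Integrable fun x => n ^ 2 * ((u x * ψ x) * lap χ (n • x)) :=
      (hi c1 s1 (continuous_lap_s13 hχ)).const_mul _
    have i2 : Integrable fun x => (u x * lap ψ x) * χ (n • x) := hi c2 s2 hχ.continuous
    have i3 : ∀ i, Integrable fun x => (u x * pder i ψ x) * pder i χ (n • x) :=
      fun i => hi (c3 i) (s3 i) (continuous_pder i hχ)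
    have i4 : Integrable fun x => 2 * (n * ∑ i, (u x * pder i ψ x) * pder i χ (n • x)) :=
      ((integrable_finsetSum _ fun i _ => i3 i).const_mul _).const_mul _
    have i12 : Integrable fun x => n ^ 2 * ((u x * ψ x) * lap χ (n • x)) +
        (u x * lap ψ x) * χ (n • x) := i1.add i2
    have i124 : Integrable fun x => n ^ 2 * ((u x * ψ x) * lap χ (n • x)) +
        (u x * lap ψ x) * χ (n • x) +
        2 * (n * ∑ i, (u x * pder i ψ x) * pder i χ (n • x)) := i12.add i4
    have e : ∫ x, u x * lap ψ x = (∫ x, u x * lap ψn x) +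
        (n ^ 2 * (∫ x, (u x * ψ x) * lap χ (n • x)) + (∫ x, (u x * lap ψ x) * χ (n • x)) +
        2 * (n * ∑ i, ∫ x, (u x * pder i ψ x) * pder i χ (n • x))) := by
      rw [integral_congr_ae (ae_of_all _ hsplit), integral_add i0 i124, integral_add i12 i4,
        integral_add i1 i2, integral_const_mul, integral_const_mul, integral_const_mul,
        integral_finsetSum _ fun i _ => i3 i]
    have b1 := (le_abs_self _).trans (h₁ n hn0)
    have b2 := (le_abs_self _).trans (h₂ n hn0)
    have b3 : ∑ i, ∫ x, (u x * pder i ψ x) * pder i χ (n • x) ≤ (∑ i, C₃ i) / n ^ N := by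
      rw [Finset.sum_div]
      exact Finset.sum_le_sum fun i _ => (le_abs_self _).trans (h₃ i n hn0)
    have hS : 0 ≤ ∑ i, C₃ i := Finset.sum_nonneg fun i _ => hC₃ i
    have hpow : ∀ j ≤ 2, ∀ C, 0 ≤ C → n ^ j * (C / n ^ N) ≤ C * n⁻¹ := by
      intro j hj C hC
      rw [mul_div_left_comm]
      refine mul_le_mul_of_nonneg_left ?_ hC
      rw [div_le_iff₀ (by positivity), le_inv_mul_iff₀ hn0, ← pow_succ']
      exact pow_le_pow_right₀ hn (by omega)
    have p1 : n ^ 2 * (∫ x, (u x * ψ x) * lap χ (n • x)) ≤ C₁ * n⁻¹ :=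
      (mul_le_mul_of_nonneg_left b1 (by positivity)).trans (hpow 2 le_rfl _ hC₁)
    have p2 : (∫ x, (u x * lap ψ x) * χ (n • x)) ≤ C₂ * n⁻¹ :=
      b2.trans (by simpa using hpow 0 (by norm_num) _ hC₂)
    have p3 : n * ∑ i, ∫ x, (u x * pder i ψ x) * pder i χ (n • x) ≤ (∑ i, C₃ i) * n⁻¹ :=
      (mul_le_mul_of_nonneg_left b3 hn0.le).trans
        (by simpa using hpow 1 (by norm_num) _ hS)
    rw [e]
    linarith
  refine ge_of_tendsto (f := fun n : ℝ => (C₁ + C₂ + 2 * ∑ i, C₃ i) * n⁻¹) (x := atTop) ?_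
    (eventually_atTop.2 ⟨1, key⟩)
  simpa using tendsto_inv_atTop_zero.const_mul (C₁ + C₂ + 2 * ∑ i, C₃ i)

end Superharmonic

section MeanValue

variable {N : ℕ} {u : EuclideanSpace ℝ (Fin N) → ℝ}

/-- A smooth nonincreasing profile whose derivative is a prescribed bump, up to a factor. -/
lemma exists_profile : ∃ F g : ℝ → ℝ, ContDiff ℝ 2 F ∧ ContDiff ℝ 2 g ∧
    (∀ s, HasDerivAt F (-(g s) / 2) s) ∧ (∀ s, 0 ≤ s → 0 ≤ F s) ∧ (∀ s, 2 ≤ s → F s = 0) ∧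
    (∀ s, 0 ≤ g s) ∧ (∀ s, 2 ≤ s → g s = 0) ∧ (∀ s, 0 ≤ s → s ≤ 1 → g s = 1) := by
  let χ : ContDiffBump (0 : ℝ) := ⟨1, 2, by norm_num, by norm_num⟩
  have hχ : ContDiff ℝ 2 χ := χ.contDiff
  have hz : ∀ s, 2 ≤ s → χ s = 0 := fun s hs => χ.zero_of_le_dist (by
    rw [Real.dist_0_eq_abs]
    exact hs.trans (le_abs_self s))
  have hd : ∀ s, HasDerivAt (fun s => -(∫ t in (2 : ℝ)..s, χ t) / 2) (-(χ s) / 2) s := fun s =>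
    ((hχ.continuous.integral_hasStrictDerivAt 2 s).hasDerivAt.neg).div_const 2
  have hF0 : ∀ s, 2 ≤ s → -(∫ t in (2 : ℝ)..s, χ t) / 2 = 0 := by
    intro s hs
    rw [intervalIntegral.integral_congr (g := fun _ => 0)]
    · simp
    · intro t ht
      rw [uIcc_of_le hs] at ht
      exact hz t ht.1
  refine ⟨fun s => -(∫ t in (2 : ℝ)..s, χ t) / 2, χ, ?_, hχ, hd, ?_, hF0,
    fun s => χ.nonneg, hz, fun s h0 h1 => χ.one_of_mem_closedBall (by simpa [abs_of_nonneg h0])⟩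
  · rw [show (2 : WithTop ℕ∞) = 1 + 1 by norm_num, contDiff_succ_iff_deriv]
    refine ⟨fun s => (hd s).differentiableAt, by simp, ?_⟩
    rw [funext fun s => (hd s).deriv]
    exact ((hχ.of_le (by norm_num)).neg).div_const 2
  · intro s hs
    rcases le_total s 2 with h | h
    · change 0 ≤ -(∫ t in (2 : ℝ)..s, χ t) / 2
      rw [intervalIntegral.integral_symm, neg_neg]
      exact div_nonneg (intervalIntegral.integral_nonneg h fun t _ => χ.nonneg) (by norm_num)
    · exact (hF0 s h).ge

lemma hasCompactSupport_of_forall_eq_zero {f : EuclideanSpace ℝ (Fin N) → ℝ}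
    (z : EuclideanSpace ℝ (Fin N)) (r : ℝ) (h : ∀ x, r < ‖x - z‖ → f x = 0) :
    HasCompactSupport f :=
  HasCompactSupport.intro (isCompact_closedBall z r) fun x hx => h x (by
    simpa [dist_eq_norm] using hx)

lemma hasDerivAt_integral_kernel_mul {K K' : ℝ → EuclideanSpace ℝ (Fin N) → ℝ}
    {z : EuclideanSpace ℝ (Fin N)} {t : ℝ} (ht : 0 < t)
    (hK : ∀ t > 0, ∀ x, HasDerivAt (fun t => K t x) (K' t x) t)
    (hKu : ∀ t > 0, Continuous fun x => K t x * u x)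
    (hK'u : ContinuousOn (fun y : ℝ × EuclideanSpace ℝ (Fin N) => K' y.1 y.2 * u y.2)
      (Ioi 0 ×ˢ univ))
    (hK0 : ∀ t > 0, ∀ x, 2 * t < ‖x - z‖ → K t x = 0)
    (hK'0 : ∀ t > 0, ∀ x, 2 * t < ‖x - z‖ → K' t x = 0) :
    HasDerivAt (fun t => ∫ x, K t x * u x) (∫ x, K' t x * u x) t := by
  obtain ⟨M, hM⟩ := ((isCompact_Icc (a := t / 2) (b := 2 * t)).prod
    (isCompact_closedBall z (4 * t))).exists_bound_of_continuousOn (hK'u.mono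
      (prod_mono (fun s hs => lt_of_lt_of_le (by positivity) hs.1) (subset_univ _)))
  have hpos : ∀ s ∈ Icc (t / 2) (2 * t), 0 < s := fun s hs =>
    lt_of_lt_of_le (by positivity) hs.1
  refine (hasDerivAt_integral_of_dominated_loc_of_deriv_le
    (F' := fun t x => K' t x * u x) (s := Icc (t / 2) (2 * t))
    (bound := (closedBall z (4 * t)).indicator fun _ => M)
    (Icc_mem_nhds (by linarith) (by linarith)) ?_ ?_ ?_ (ae_of_all _ ?_) ?_
    (ae_of_all _ ?_)).2
  · filter_upwards [lt_mem_nhds ht] with s hs using (hKu s hs).aestronglyMeasurable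
  · refine (hKu t ht).integrable_of_hasCompactSupport
      (hasCompactSupport_of_forall_eq_zero z (2 * t) fun x hx => ?_)
    simp [hK0 t ht x hx]
  · have : Continuous fun x => K' t x * u x := by
      have h1 : Continuous fun x : EuclideanSpace ℝ (Fin N) => (t, x) := by fun_prop
      exact hK'u.comp_continuous h1 fun x => ⟨ht, trivial⟩
    exact this.aestronglyMeasurable
  · intro x s hs'
    by_cases hx : x ∈ closedBall z (4 * t)
    · rw [indicator_of_mem hx]
      exact hM (s, x) ⟨hs', hx⟩
    · rw [indicator_of_notMem hx, hK'0 s (hpos s hs') x, zero_mul, norm_zero]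
      rw [mem_closedBall, dist_eq_norm, not_le] at hx
      linarith [hs'.2]
  · exact (integrable_indicator_iff measurableSet_closedBall).2
      (integrableOn_const (isCompact_closedBall z _).measure_lt_top.ne)
  · intro x s hs'
    exact (hK s (hpos s hs') x).mul_const (u x)

/-- Weighted averages of a superharmonic function over balls decrease with the radius. -/
lemma antitoneOn_weighted_average (hN : 3 ≤ N) (hu : Continuous u) (hu2 : ContDiffOn ℝ 2 u {0}ᶜ)
    (hs : ∀ x ≠ 0, lap u x ≤ 0) {F g : ℝ → ℝ} (hF : ContDiff ℝ 2 F) (hg : ContDiff ℝ 2 g)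
    (hFg : ∀ s, HasDerivAt F (-(g s) / 2) s) (hF0 : ∀ s, 0 ≤ s → 0 ≤ F s)
    (hF2 : ∀ s, 2 ≤ s → F s = 0) (hg2 : ∀ s, 2 ≤ s → g s = 0) (z : EuclideanSpace ℝ (Fin N)) :
    AntitoneOn (fun t : ℝ => ∫ x, g (‖x - z‖ ^ 2 / t ^ 2) / t ^ N * u x) (Ioi 0) := by
  have hgd : ∀ s, HasDerivAt g (deriv g s) s := fun s =>
    (hg.differentiable (by norm_num) s).hasDerivAt
  have hg' : Continuous (deriv g) := hg.continuous_deriv (by norm_num)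
  have hg'2 : ∀ s, 2 < s → deriv g s = 0 := by
    intro s h
    have : g =ᶠ[nhds s] fun _ => 0 := by
      filter_upwards [lt_mem_nhds h] with y hy using hg2 y hy.le
    simp [this.deriv_eq]
  let K' : ℝ → EuclideanSpace ℝ (Fin N) → ℝ := fun t x =>
    (deriv g (‖x - z‖ ^ 2 / t ^ 2) * (-2 * ‖x - z‖ ^ 2 / t ^ 3)) / t ^ N
      - N * g (‖x - z‖ ^ 2 / t ^ 2) / t ^ (N + 1)
  have hK : ∀ t > 0, ∀ x : EuclideanSpace ℝ (Fin N),
      HasDerivAt (fun t => g (‖x - z‖ ^ 2 / t ^ 2) / t ^ N) (K' t x) t := by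
    intro t ht x
    have h1 : HasDerivAt (fun t : ℝ => ‖x - z‖ ^ 2 / t ^ 2) (-2 * ‖x - z‖ ^ 2 / t ^ 3) t := by
      have := (hasDerivAt_const t (‖x - z‖ ^ 2)).fun_div (hasDerivAt_pow 2 t) (by positivity)
      refine this.congr_deriv ?_
      field_simp
      ring
    have h2 := ((hgd (‖x - z‖ ^ 2 / t ^ 2)).comp t h1).fun_div (hasDerivAt_pow N t) (by positivity)
    refine h2.congr_deriv ?_
    simp only [K', Function.comp]
    obtain ⟨m, rfl⟩ : ∃ m, N = m + 1 := ⟨N - 1, by omega⟩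
    simp only [Nat.add_sub_cancel]
    field_simp
    ring
  have hsmall : ∀ {t r : ℝ}, 0 < t → 2 * t < r → 2 < r ^ 2 / t ^ 2 := by
    intro t r ht hr
    rw [lt_div_iff₀ (by positivity)]
    nlinarith
  have hK0 : ∀ t > 0, ∀ x, 2 * t < ‖x - z‖ → K' t x = 0 := by
    intro t ht x hx
    have := hsmall ht hx
    simp [K', hg2 _ this.le, hg'2 _ this]
  have hKc : ContinuousOn (fun y : ℝ × EuclideanSpace ℝ (Fin N) => K' y.1 y.2 * u y.2)
      (Ioi 0 ×ˢ univ) := by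
    have hne : ∀ y ∈ (Ioi (0 : ℝ) ×ˢ (univ : Set (EuclideanSpace ℝ (Fin N)))), y.1 ≠ 0 :=
      fun y hy => ne_of_gt hy.1
    have h1 : ContinuousOn (fun y : ℝ × EuclideanSpace ℝ (Fin N) => ‖y.2 - z‖ ^ 2 / y.1 ^ 2)
        (Ioi 0 ×ˢ univ) :=
      ContinuousOn.div (by fun_prop) (by fun_prop) fun y hy => pow_ne_zero _ (hne y hy)
    refine ContinuousOn.mul (ContinuousOn.sub (ContinuousOn.div (ContinuousOn.mul
      (hg'.comp_continuousOn h1) (ContinuousOn.div (by fun_prop) (by fun_prop) fun y hy =>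
        pow_ne_zero _ (hne y hy))) (by fun_prop) fun y hy => pow_ne_zero _ (hne y hy))
      (ContinuousOn.div (continuousOn_const.mul (hg.continuous.comp_continuousOn h1))
        (by fun_prop) fun y hy => pow_ne_zero _ (hne y hy))) (by fun_prop)
  have hAc : ∀ t > 0, Continuous fun x => g (‖x - z‖ ^ 2 / t ^ 2) / t ^ N * u x := by
    intro t ht
    have := hg.continuous
    fun_prop
  have hAd : ∀ t > 0, HasDerivAt (fun t : ℝ => ∫ x, g (‖x - z‖ ^ 2 / t ^ 2) / t ^ N * u x)
      (∫ x, K' t x * u x) t := fun t ht =>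
    hasDerivAt_integral_kernel_mul ht hK hAc hKc
      (fun t ht x hx => by simp [hg2 _ (hsmall ht hx).le]) hK0
  have hle : ∀ t > 0, ∫ x, K' t x * u x ≤ 0 := by
    intro t ht
    have hψ : ContDiff ℝ 2 fun x : EuclideanSpace ℝ (Fin N) => (t⁻¹) ^ 2 * ‖x - z‖ ^ 2 :=
      contDiff_const.mul (contDiff_norm_sq_sub z)
    have hFψ : ContDiff ℝ 2 fun x : EuclideanSpace ℝ (Fin N) => F ((t⁻¹) ^ 2 * ‖x - z‖ ^ 2) :=
      hF.comp hψ
    have hlap : ∀ x, lap (fun x => t / t ^ N * F ((t⁻¹) ^ 2 * ‖x - z‖ ^ 2)) x = K' t x := by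
      intro x
      rw [lap_const_mul (f := fun x => F ((t⁻¹) ^ 2 * ‖x - z‖ ^ 2)) _ hFψ.contDiffAt,
        lap_comp hψ.contDiffAt hF.contDiffAt (Eventually.of_forall hFg)
          (((hgd _).neg).div_const 2),
        lap_const_mul (f := fun x => ‖x - z‖ ^ 2) _ (contDiff_norm_sq_sub z).contDiffAt,
        lap_norm_sq_sub, fderiv_const_mul
          ((contDiff_norm_sq_sub z (n := 1)).differentiable (by norm_num) x),
        norm_smul, fderiv_norm_sq_sub]
      have : (t⁻¹) ^ 2 * ‖x - z‖ ^ 2 = ‖x - z‖ ^ 2 / t ^ 2 := by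
        rw [inv_pow]
        ring
      rw [this, Real.norm_of_nonneg (by positivity)]
      simp only [K']
      field_simp
      ring
    have := integral_mul_lap_nonpos hN hu hu2 hs
      (ψ := fun x => t / t ^ N * F ((t⁻¹) ^ 2 * ‖x - z‖ ^ 2)) (contDiff_const.mul hFψ)
      (hasCompactSupport_of_forall_eq_zero z (2 * t) fun x hx => by
        have := hsmall ht hx
        rw [hF2, mul_zero]
        rw [inv_pow, inv_mul_eq_div]
        exact this.le)
      (fun x => mul_nonneg (by positivity) (hF0 _ (by positivity)))
    simp_rw [hlap] at this
    refine le_trans (le_of_eq ?_) this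
    exact integral_congr_ae (ae_of_all _ fun x => mul_comm (K' t x) (u x))
  refine antitoneOn_of_deriv_nonpos (convex_Ioi 0)
    (fun t ht => (hAd t ht).continuousAt.continuousWithinAt) (fun t ht => ?_) (fun t ht => ?_)
  · rw [interior_Ioi] at ht
    exact (hAd t ht).differentiableAt.differentiableWithinAt
  · rw [interior_Ioi] at ht
    rw [(hAd t ht).deriv]
    exact hle t ht

/-- Weak Harnack inequality for positive superharmonic functions. -/
lemma exists_mul_integral_le (hN : 3 ≤ N) :
    ∃ c > 0, ∀ u : EuclideanSpace ℝ (Fin N) → ℝ, Continuous u → ContDiffOn ℝ 2 u {0}ᶜ →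
      (∀ x, 0 < u x) → (∀ x ≠ 0, lap u x ≤ 0) → ∀ z ∈ closedBall (0 : EuclideanSpace ℝ (Fin N)) 2,
        c * ∫ x in closedBall 0 2, u x ≤ u z := by
  obtain ⟨F, g, hF, hg, hFg, hF0, hF2, hg0, hg2, hg1⟩ := exists_profile
  have hgc : Continuous fun y : EuclideanSpace ℝ (Fin N) => g (‖y‖ ^ 2) :=
    hg.continuous.comp (by fun_prop)
  have hgz : ∀ y : EuclideanSpace ℝ (Fin N), y ∉ closedBall 0 2 → g (‖y‖ ^ 2) = 0 := by
    intro y hy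
    rw [mem_closedBall_zero_iff, not_le] at hy
    exact hg2 _ (by nlinarith)
  set S := ∫ y in closedBall (0 : EuclideanSpace ℝ (Fin N)) 2, g (‖y‖ ^ 2) with hS
  have hS0 : 0 ≤ S := integral_nonneg fun _ => hg0 _
  refine ⟨((4 : ℝ) ^ N * (S + 1))⁻¹, by positivity, fun u hu hu2 hpos hs z hz => ?_⟩
  have hanti := antitoneOn_weighted_average hN hu hu2 hs hF hg hFg hF0 hF2 hg2 z
  set A : ℝ → ℝ := fun t : ℝ => ∫ x, g (‖x - z‖ ^ 2 / t ^ 2) / t ^ N * u x with hA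
  have hAB : ∀ t > 0, A t = ∫ y in closedBall (0 : EuclideanSpace ℝ (Fin N)) 2,
      g (‖y‖ ^ 2) * u (t • y + z) := by
    intro t ht
    rw [setIntegral_eq_integral_of_forall_compl_eq_zero
      fun y hy => by rw [hgz y hy, zero_mul]]
    have h1 : A t = ∫ x, g (‖x‖ ^ 2 / t ^ 2) / t ^ N * u (x + z) := by
      rw [← integral_add_right_eq_self _ (-z)]
      simp [hA, sub_eq_add_neg]
    have h2 := Measure.integral_comp_smul_of_nonneg volume
      (fun x : EuclideanSpace ℝ (Fin N) => g (‖x‖ ^ 2 / t ^ 2) / t ^ N * u (x + z)) t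
      (hR := ht.le)
    rw [h1]
    rw [finrank_euclideanSpace_fin, smul_eq_mul, eq_inv_mul_iff_mul_eq₀ (by positivity),
      ← integral_const_mul] at h2
    rw [← h2]
    refine integral_congr_ae (ae_of_all _ fun y => ?_)
    change t ^ N * (g (‖t • y‖ ^ 2 / t ^ 2) / t ^ N * u (t • y + z)) = _
    rw [norm_smul, Real.norm_of_nonneg ht.le, mul_pow, mul_div_cancel_left₀ _ (by positivity)]
    field_simp
  have hBc : Continuous fun t : ℝ => ∫ y in closedBall (0 : EuclideanSpace ℝ (Fin N)) 2,
      g (‖y‖ ^ 2) * u (t • y + z) := by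
    refine continuous_parametric_integral_of_continuous ?_ (isCompact_closedBall 0 2)
    exact (hgc.comp continuous_snd).mul (hu.comp (by fun_prop))
  have hlim : A 4 ≤ S * u z := by
    have h0 := hBc.continuousWithinAt (s := Ioi 0) (x := 0)
    have e0 : ∫ y in closedBall (0 : EuclideanSpace ℝ (Fin N)) 2,
        g (‖y‖ ^ 2) * u ((0 : ℝ) • y + z) = S * u z := by
      simp only [zero_smul, zero_add]
      rw [integral_mul_const]
    rw [ContinuousWithinAt, e0] at h0
    refine ge_of_tendsto h0 ?_
    have : Ioo (0 : ℝ) 4 ∈ nhdsWithin 0 (Ioi 0) := Ioo_mem_nhdsGT (by norm_num)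
    filter_upwards [this] with t ht
    rw [← hAB t ht.1]
    exact hanti ht.1 (by norm_num) ht.2.le
  have hlow : (∫ x in closedBall 0 2, u x) ≤ 4 ^ N * A 4 := by
    have hgint : Integrable fun x => 4 ^ N * (g (‖x - z‖ ^ 2 / 4 ^ 2) / 4 ^ N * u x) := by
      refine Continuous.integrable_of_hasCompactSupport ?_
        (hasCompactSupport_of_forall_eq_zero z 8 fun x hx => ?_)
      · have := hg.continuous
        fun_prop
      · rw [hg2]
        · simp
        · nlinarith
    rw [hA, ← integral_const_mul, ← integral_indicator measurableSet_closedBall]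
    refine integral_mono ((hu.continuousOn.integrableOn_compact
      (isCompact_closedBall 0 2)).integrable_indicator measurableSet_closedBall) hgint fun x => ?_
    change _ ≤ 4 ^ N * (g (‖x - z‖ ^ 2 / 4 ^ 2) / 4 ^ N * u x)
    by_cases hx : x ∈ closedBall (0 : EuclideanSpace ℝ (Fin N)) 2
    · rw [indicator_of_mem hx, hg1 _ (by positivity)]
      · field_simp
        exact le_rfl
      · rw [mem_closedBall_zero_iff] at hx hz
        have := norm_sub_le x z
        rw [div_le_one (by norm_num)]
        exact pow_le_pow_left₀ (norm_nonneg _) (by linarith) 2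
    · rw [indicator_of_notMem hx]
      have := (hpos x).le
      have := hg0 (‖x - z‖ ^ 2 / 4 ^ 2)
      positivity
  rw [inv_mul_le_iff₀ (by positivity)]
  have := (hpos z).le
  calc (∫ x in closedBall 0 2, u x) ≤ 4 ^ N * A 4 := hlow
    _ ≤ 4 ^ N * (S * u z) := by gcongr
    _ ≤ 4 ^ N * (S + 1) * u z := by
        have : (0 : ℝ) ≤ 4 ^ N * u z := by positivity
        linarith

end MeanValue

section Annulus

variable {N : ℕ} {u : EuclideanSpace ℝ (Fin N) → ℝ}

lemma exists_annulus_cutoff (N : ℕ) : ∃ φ : EuclideanSpace ℝ (Fin N) → ℝ, ContDiff ℝ 2 φ ∧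
    (∀ x, 0 ≤ φ x) ∧ (∀ x, φ x ≤ 1) ∧ (∀ x, 1 / 2 ≤ ‖x‖ → ‖x‖ ≤ 1 → φ x = 1) ∧
    (0 : _) ∉ tsupport φ ∧ tsupport φ ⊆ closedBall 0 2 := by
  let χ : ContDiffBump (5 / 8 : ℝ) := ⟨3 / 8, 1 / 2, by norm_num, by norm_num⟩
  refine ⟨fun x => χ (‖x‖ ^ 2), χ.contDiff.comp (contDiff_norm_sq ℝ), fun x => χ.nonneg,
    fun x => χ.le_one, fun x h1 h2 => χ.one_of_mem_closedBall ?_, ?_, ?_⟩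
  · rw [mem_closedBall, Real.dist_eq, abs_le]
    change -(3 / 8) ≤ _ ∧ _ ≤ (3 / 8 : ℝ)
    constructor <;> nlinarith
  · rw [notMem_tsupport_iff_eventuallyEq]
    have : ball (0 : EuclideanSpace ℝ (Fin N)) (1 / 4) ∈ nhds 0 := ball_mem_nhds _ (by norm_num)
    filter_upwards [this] with x hx
    rw [mem_ball_zero_iff] at hx
    refine χ.zero_of_le_dist ?_
    rw [Real.dist_eq, le_abs]
    right
    change (1 / 2 : ℝ) ≤ _
    nlinarith [norm_nonneg x]
  · refine closure_minimal (fun x hx => ?_) isClosed_closedBall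
    by_contra h
    rw [mem_closedBall_zero_iff, not_le] at h
    refine hx (χ.zero_of_le_dist ?_)
    rw [Real.dist_eq, le_abs]
    left
    change (1 / 2 : ℝ) ≤ _
    nlinarith

lemma measurableSet_annulus (r R : ℝ) :
    MeasurableSet {x : EuclideanSpace ℝ (Fin N) | r < ‖x‖ ∧ ‖x‖ < R} :=
  (measurableSet_lt measurable_const measurable_norm).inter
    (measurableSet_lt measurable_norm measurable_const)

lemma integrableOn_annulus {G : EuclideanSpace ℝ (Fin N) → ℝ} (hG : ContinuousOn G {0}ᶜ) :
    IntegrableOn G {x | 1 / 2 < ‖x‖ ∧ ‖x‖ < 1} := by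
  have hK : IsCompact (closedBall (0 : EuclideanSpace ℝ (Fin N)) 1 ∩ {x | 1 / 2 ≤ ‖x‖}) :=
    (isCompact_closedBall 0 1).inter_right (isClosed_le continuous_const continuous_norm)
  refine ((hG.mono ?_).integrableOn_compact hK).mono_set ?_
  · rintro x ⟨-, hx⟩ rfl
    norm_num at hx
  · exact fun x hx => ⟨mem_closedBall_zero_iff.2 hx.2.le, hx.1.le⟩

lemma setIntegral_annulus_le_integral_mul {φ G : EuclideanSpace ℝ (Fin N) → ℝ}
    (hφ : ContDiff ℝ 2 φ) (hφ0 : ∀ x, 0 ≤ φ x) (hφ1 : ∀ x, 1 / 2 ≤ ‖x‖ → ‖x‖ ≤ 1 → φ x = 1)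
    (h0 : (0 : _) ∉ tsupport φ) (hc : HasCompactSupport φ)
    (hG : ContinuousOn G {0}ᶜ) (hG0 : ∀ x, 0 ≤ G x) :
    ∫ x in {x | 1 / 2 < ‖x‖ ∧ ‖x‖ < 1}, G x ≤ ∫ x, φ x * G x := by
  have hi : Integrable fun x => φ x * G x :=
    (continuous_mul_of_zero_notMem_tsupport hφ.continuous.continuousOn h0
      hG).integrable_of_hasCompactSupport hc.mul_right
  rw [setIntegral_congr_fun (measurableSet_annulus _ _) (g := fun x => φ x * G x)
    fun x hx => by simp [hφ1 x hx.1.le hx.2.le]]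
  exact setIntegral_le_integral hi (ae_of_all _ fun x => mul_nonneg (hφ0 x) (hG0 x))

lemma exists_integral_mul_neg_lap_le {φ : EuclideanSpace ℝ (Fin N) → ℝ}
    (hφ : ContDiff ℝ 2 φ) (h0 : (0 : _) ∉ tsupport φ) (hb : tsupport φ ⊆ closedBall 0 2) :
    ∃ C > 0, ∀ z : EuclideanSpace ℝ (Fin N) → ℝ, Continuous z → ContDiffOn ℝ 2 z {0}ᶜ →
      (∀ x, 0 ≤ z x) → ∫ x, φ x * -lap z x ≤ C * ∫ x in closedBall 0 2, z x := by
  have hc : HasCompactSupport φ :=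
    (isCompact_closedBall 0 2).of_isClosed_subset (isClosed_tsupport _) hb
  obtain ⟨M, hM⟩ := (hasCompactSupport_lap hφ hc).exists_bound_of_continuous (continuous_lap_s13 hφ)
  have hM0 : 0 ≤ M := (norm_nonneg _).trans (hM 0)
  refine ⟨M + 1, by positivity, fun z hz hz2 hz0 => ?_⟩
  simp_rw [mul_neg]
  rw [integral_neg, integral_mul_lap_comm hz2 hφ hc h0, ← integral_neg,
    ← integral_const_mul, ← integral_indicator measurableSet_closedBall]
  have i1 : Integrable fun x => -(z x * lap φ x) :=
    ((hz.mul (continuous_lap_s13 hφ)).integrable_of_hasCompactSupport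
      (hasCompactSupport_lap hφ hc).mul_left).neg
  refine integral_mono i1 (((hz.const_mul _).continuousOn.integrableOn_compact
      (isCompact_closedBall 0 2)).integrable_indicator measurableSet_closedBall) fun x => ?_
  change -(z x * lap φ x) ≤ _
  by_cases hx : x ∈ closedBall (0 : EuclideanSpace ℝ (Fin N)) 2
  · rw [indicator_of_mem hx]
    have h := neg_abs_le (lap φ x)
    have h' : |lap φ x| ≤ M := hM x
    nlinarith [hz0 x]
  · rw [indicator_of_notMem hx, image_eq_zero_of_notMem_tsupport
      fun h => hx (hb (tsupport_lap_subset hφ h))]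
    simp

lemma exists_integral_annulus_abs_lap_le (N : ℕ) :
    ∃ C > 0, ∀ u : EuclideanSpace ℝ (Fin N) → ℝ, Continuous u → ContDiffOn ℝ 2 u {0}ᶜ →
      (∀ x, 0 < u x) → (∀ x ≠ 0, lap u x ≤ 0) →
        ∫ x in {x | 1 / 2 < ‖x‖ ∧ ‖x‖ < 1}, |lap u x| ≤ C * ∫ x in closedBall 0 2, u x := by
  obtain ⟨φ, hφ, hφ0, -, hφ1, h0, hb⟩ := exists_annulus_cutoff N
  have hc : HasCompactSupport φ :=
    (isCompact_closedBall 0 2).of_isClosed_subset (isClosed_tsupport _) hb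
  obtain ⟨C, hC, h⟩ := exists_integral_mul_neg_lap_le hφ h0 hb
  refine ⟨C, hC, fun u hu hu2 hpos hs => le_trans ?_ (h u hu hu2 fun x => (hpos x).le)⟩
  refine (setIntegral_annulus_le_integral_mul hφ hφ0 hφ1 h0 hc
    (continuousOn_lap hu2).abs fun x => abs_nonneg _).trans (le_of_eq ?_)
  refine integral_congr_ae (ae_of_all _ fun x => ?_)
  change φ x * |lap u x| = φ x * -lap u x
  by_cases hx : x = 0
  · subst hx
    simp [image_eq_zero_of_notMem_tsupport h0]
  · rw [abs_of_nonpos (hs x hx)]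

lemma norm_gradient (x : EuclideanSpace ℝ (Fin N)) : ‖gradient u x‖ = ‖fderiv ℝ u x‖ := by
  rw [← toDual_gradient, LinearIsometryEquiv.norm_map]

/-- Superharmonicity controls the gradient of a concave power. -/
lemma rpow_mul_sq_norm_fderiv_le {γ : ℝ} {x : EuclideanSpace ℝ (Fin N)} (hγ0 : 0 < γ)
    (hu2 : ContDiffAt ℝ 2 u x) (hpos : 0 < u x) (hs : lap u x ≤ 0) :
    γ * (1 - γ) * ((1 + u x) ^ (γ - 2) * ‖fderiv ℝ u x‖ ^ 2) ≤
      -lap (fun y => (1 + u y) ^ γ) x := by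
  have hd : ∀ r s : ℝ, 0 < s → HasDerivAt (fun s => (1 + s) ^ r) (r * (1 + s) ^ (r - 1)) s := by
    intro r s hs'
    have := ((hasDerivAt_id s).const_add 1).rpow_const (p := r) (Or.inl (by simp; linarith))
    simpa using this
  have hc : ContDiffAt ℝ 2 (fun s : ℝ => (1 + s) ^ γ) (u x) :=
    (contDiffAt_const.add contDiffAt_id).rpow_const_of_ne (by simp; linarith)
  rw [lap_comp (h := fun s : ℝ => (1 + s) ^ γ) hu2 hc
    ((lt_mem_nhds hpos).mono fun s hs' => hd γ s hs') ((hd (γ - 1) (u x) hpos).const_mul γ)]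
  have h1 : 0 ≤ γ * (1 + u x) ^ (γ - 1) := by positivity
  rw [show γ - 1 - 1 = γ - 2 by ring]
  nlinarith [mul_nonneg h1 (neg_nonneg.2 hs)]

lemma contDiffAt_one_add_rpow {γ : ℝ} {x : EuclideanSpace ℝ (Fin N)}
    (hu2 : ContDiffAt ℝ 2 u x) (hpos : 0 < u x) : ContDiffAt ℝ 2 (fun y => (1 + u y) ^ γ) x :=
  (contDiffAt_const.add hu2).rpow_const_of_ne (by linarith)

lemma norm_fderiv_one_add_rpow {γ : ℝ} {x : EuclideanSpace ℝ (Fin N)} (hγ0 : 0 < γ)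
    (hu : DifferentiableAt ℝ u x) (hpos : 0 < u x) :
    ‖fderiv ℝ (fun y => (1 + u y) ^ γ) x‖ = γ * (1 + u x) ^ (γ - 1) * ‖fderiv ℝ u x‖ := by
  have h := ((hu.hasFDerivAt.const_add 1).rpow_const (p := γ) (Or.inl (by linarith))).fderiv
  rw [h, norm_smul, Real.norm_of_nonneg (by positivity)]

lemma integrableOn_closedBall {z : EuclideanSpace ℝ (Fin N) → ℝ} (hz : Continuous z) (r : ℝ) :
    IntegrableOn z (closedBall 0 r) :=
  hz.continuousOn.integrableOn_compact (isCompact_closedBall 0 r)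

/-- The gradient of a positive superharmonic function is integrable on the annulus, with a bound
depending only on the mass of the function. -/
lemma exists_integral_annulus_gradient_le (hN : 3 ≤ N) (M : ℝ) :
    ∃ C, ∀ u : EuclideanSpace ℝ (Fin N) → ℝ, Continuous u → ContDiffOn ℝ 2 u {0}ᶜ →
      (∀ x, 0 < u x) → (∀ x ≠ 0, lap u x ≤ 0) → ∫ x in closedBall 0 2, u x ≤ M →
        ∫ x in {x | 1 / 2 < ‖x‖ ∧ ‖x‖ < 1}, ‖gradient u x‖ ≤ C := by
  obtain ⟨φ, hφ, hφ0, hφle, hφ1, h0, hb⟩ := exists_annulus_cutoff N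
  have hc : HasCompactSupport φ :=
    (isCompact_closedBall 0 2).of_isClosed_subset (isClosed_tsupport _) hb
  obtain ⟨C₁, hC₁, h₁⟩ := exists_integral_mul_neg_lap_le hφ h0 hb
  obtain ⟨M₁, hM₁⟩ := (hc.fderiv ℝ).exists_bound_of_continuous
    (hφ.continuous_fderiv (by norm_num))
  have hM₁0 : 0 ≤ M₁ := (norm_nonneg _).trans (hM₁ 0)
  have hN' : (3 : ℝ) ≤ N := by exact_mod_cast hN
  set γ : ℝ := (2 * N - 2) / (2 * N - 1) with hγ
  have hγ0 : 0 < γ := by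
    apply div_pos <;> linarith
  have hγ1 : γ < 1 := by
    rw [hγ, div_lt_one] <;> linarith
  set p : ℝ := N / (N - 1) with hp
  have hp0 : 0 < p := by
    apply div_pos <;> linarith
  have hγp : γ * p = 2 - γ := by
    have h1 : (2 * N - 1 : ℝ) ≠ 0 := by linarith
    have h2 : (N - 1 : ℝ) ≠ 0 := by linarith
    rw [hγ, hp]
    field_simp
    ring
  set V := volume.real (closedBall (0 : EuclideanSpace ℝ (Fin N)) 2) with hV
  set B₁ := C₁ * (V + M) / (γ * (1 - γ)) with hB₁
  set B₂ := B₁ + (1 + M₁) * (V + M) with hB₂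
  set B₃ := (lintegralPowLePowLIntegralFDerivConst
    (volume : Measure (EuclideanSpace ℝ (Fin N))) p * ENNReal.ofReal B₂ ^ p).toReal with hB₃
  refine ⟨B₁ + B₃, fun u hu hu2 hpos hs hM => ?_⟩
  have hw : ∀ x, 1 ≤ 1 + u x := fun x => by linarith [hpos x]
  have hw0 : ∀ x, 0 < 1 + u x := fun x => by linarith [hpos x]
  set z : EuclideanSpace ℝ (Fin N) → ℝ := fun x => (1 + u x) ^ γ with hz
  have hzc : Continuous z := (continuous_const.add hu).rpow_const fun x => Or.inl (hw0 x).ne'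
  have hz2 : ContDiffOn ℝ 2 z {0}ᶜ := fun x hx =>
    (contDiffAt_one_add_rpow (contDiffAt_of_punctured hu2 hx) (hpos x)).contDiffWithinAt
  have hz0 : ∀ x, 0 ≤ z x := fun x => Real.rpow_nonneg (hw0 x).le _
  have hzw : ∀ x, z x ≤ 1 + u x := fun x =>
    (Real.rpow_le_rpow_of_exponent_le (hw x) hγ1.le).trans_eq (Real.rpow_one _)
  have hIw : ∫ x in closedBall 0 2, (1 + u x) ≤ V + M := by
    rw [integral_add (integrableOn_closedBall continuous_const 2) (integrableOn_closedBall hu 2)]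
    simpa [hV] using hM
  have hIz : ∫ x in closedBall 0 2, z x ≤ V + M :=
    (integral_mono (integrableOn_closedBall hzc 2)
      (integrableOn_closedBall (continuous_const.add hu) 2) hzw).trans hIw
  set d : EuclideanSpace ℝ (Fin N) → ℝ := fun x => ‖fderiv ℝ u x‖ with hd
  have hdc : ContinuousOn d {0}ᶜ := fun x hx => ((contDiffAt_of_punctured hu2 hx).fderiv_right
    (m := 0) (by norm_num)).continuousAt.norm.continuousWithinAt
  set Q : EuclideanSpace ℝ (Fin N) → ℝ := fun x => (1 + u x) ^ (γ - 2) * d x ^ 2 with hQ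
  have hQ0 : ∀ x, 0 ≤ Q x := fun x =>
    mul_nonneg (Real.rpow_nonneg (hw0 x).le _) (sq_nonneg _)
  have hQc : ContinuousOn Q {0}ᶜ :=
    ((continuous_const.add hu).rpow_const fun x => Or.inl (hw0 x).ne').continuousOn.mul
      (hdc.pow 2)
  have hcut : ∀ G : EuclideanSpace ℝ (Fin N) → ℝ, ContinuousOn G {0}ᶜ →
      Integrable fun x => φ x * G x := fun G hG =>
    (continuous_mul_of_zero_notMem_tsupport hφ.continuous.continuousOn h0
      hG).integrable_of_hasCompactSupport hc.mul_right
  have hIQ : ∫ x, φ x * Q x ≤ B₁ := by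
    have hpos' : 0 < γ * (1 - γ) := mul_pos hγ0 (by linarith)
    rw [hB₁, le_div_iff₀' hpos', ← integral_const_mul]
    calc ∫ x, γ * (1 - γ) * (φ x * Q x) ≤ ∫ x, φ x * -lap z x := by
          refine integral_mono ((hcut Q hQc).const_mul _) (hcut _ (continuousOn_lap hz2).neg)
            fun x => ?_
          change γ * (1 - γ) * (φ x * Q x) ≤ φ x * -lap z x
          by_cases hx : x = 0
          · subst hx
            simp [image_eq_zero_of_notMem_tsupport h0]
          · rw [mul_left_comm]
            exact mul_le_mul_of_nonneg_left (rpow_mul_sq_norm_fderiv_le hγ0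
              (contDiffAt_of_punctured hu2 hx) (hpos x) (hs x hx)) (hφ0 x)
      _ ≤ C₁ * ∫ x in closedBall 0 2, z x := h₁ z hzc hz2 hz0
      _ ≤ C₁ * (V + M) := by gcongr
  set f : EuclideanSpace ℝ (Fin N) → ℝ := fun x => φ x * z x with hf
  have hf0 : ∀ x, 0 ≤ f x := fun x => mul_nonneg (hφ0 x) (hz0 x)
  have hfc : HasCompactSupport f := hc.mul_right
  have hf1 : ContDiff ℝ 1 f := by
    refine contDiff_iff_contDiffAt.2 fun x => ?_
    by_cases hx : x = 0
    · subst hx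
      have : f =ᶠ[nhds 0] fun _ => 0 := by
        filter_upwards [notMem_tsupport_iff_eventuallyEq.1 h0] with y hy
        simp [hf, hy]
      exact contDiffAt_const.congr_of_eventuallyEq this
    · exact (hφ.contDiffAt.mul (contDiffAt_of_punctured hz2 hx)).of_le (by norm_num)
  have hDf : ∀ x, ‖fderiv ℝ f x‖ ≤
      φ x * Q x + (closedBall 0 2).indicator (fun x => (1 + M₁) * (1 + u x)) x := by
    intro x
    by_cases hxb : x ∈ tsupport φ
    · have hx : x ≠ 0 := by
        rintro rfl
        exact h0 hxb
      have hux := contDiffAt_of_punctured hu2 hx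
      rw [indicator_of_mem (hb hxb), hf, fderiv_fun_mul (hφ.differentiable (by norm_num) x)
        ((contDiffAt_of_punctured hz2 hx).differentiableAt (by norm_num))]
      refine (norm_add_le _ _).trans ?_
      rw [norm_smul, norm_smul, hz, norm_fderiv_one_add_rpow hγ0
        (hux.differentiableAt (by norm_num)) (hpos x), Real.norm_of_nonneg (hφ0 x)]
      change _ + ‖z x‖ * _ ≤ _
      rw [Real.norm_of_nonneg (hz0 x)]
      have e1 : z x * ‖fderiv ℝ φ x‖ ≤ M₁ * (1 + u x) := by
        rw [mul_comm]
        exact mul_le_mul (hM₁ x) (hzw x) (hz0 x) hM₁0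
      have e2 : (1 + u x) ^ (γ - 1) * d x ≤ Q x + z x := by
        have a1 : (1 + u x) ^ (γ - 1) = (1 + u x) ^ (γ - 2) * (1 + u x) := by
          rw [← Real.rpow_add_one (hw0 x).ne']
          congr 1
          ring
        have a2 : z x = (1 + u x) ^ (γ - 2) * (1 + u x) ^ 2 := by
          rw [hz, ← Real.rpow_natCast, ← Real.rpow_add (hw0 x)]
          change (1 + u x) ^ γ = _
          congr 1
          push_cast
          ring
        rw [a1, a2, hQ]
        have : 0 < (1 + u x) ^ (γ - 2) := Real.rpow_pos_of_pos (hw0 x) _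
        have h3 : (1 + u x) * d x ≤ d x ^ 2 + (1 + u x) ^ 2 := by
          nlinarith [sq_nonneg (1 + u x - d x), sq_nonneg (1 + u x), sq_nonneg (d x)]
        nlinarith [mul_le_mul_of_nonneg_left h3 this.le]
      have e3 : φ x * (γ * (1 + u x) ^ (γ - 1) * d x) ≤ φ x * Q x + (1 + u x) := by
        have e4 : 0 ≤ (1 + u x) ^ (γ - 1) * d x :=
          mul_nonneg (Real.rpow_nonneg (hw0 x).le _) (norm_nonneg _)
        calc φ x * (γ * (1 + u x) ^ (γ - 1) * d x)
            ≤ φ x * ((1 + u x) ^ (γ - 1) * d x) := by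
              refine mul_le_mul_of_nonneg_left ?_ (hφ0 x)
              rw [mul_assoc]
              exact mul_le_of_le_one_left e4 hγ1.le
          _ ≤ φ x * (Q x + z x) := mul_le_mul_of_nonneg_left e2 (hφ0 x)
          _ ≤ φ x * Q x + (1 + u x) := by
              rw [mul_add]
              have := mul_le_of_le_one_left (hz0 x) (hφle x)
              linarith [hzw x]
      change φ x * (γ * (1 + u x) ^ (γ - 1) * d x) + _ ≤ _
      linarith
    · have hfe : f =ᶠ[nhds x] fun _ => 0 := by
        filter_upwards [notMem_tsupport_iff_eventuallyEq.1 hxb] with y hy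
        simp [hf, hy]
      rw [hfe.fderiv_eq]
      simp only [fderiv_fun_const, Pi.zero_apply, norm_zero]
      exact add_nonneg (mul_nonneg (hφ0 x) (hQ0 x)) (indicator_nonneg
        (fun y _ => mul_nonneg (by positivity) (hw0 y).le) _)
  have hIDf : ∫ x, ‖fderiv ℝ f x‖ ≤ B₂ := by
    have i1 : Integrable fun x => ‖fderiv ℝ f x‖ :=
      ((hf1.continuous_fderiv (by norm_num)).integrable_of_hasCompactSupport
        (hfc.fderiv ℝ)).norm
    have i2 : Integrable ((closedBall 0 2).indicator fun x => (1 + M₁) * (1 + u x)) :=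
      (integrableOn_closedBall (continuous_const.mul (continuous_const.add hu))
        2).integrable_indicator measurableSet_closedBall
    refine (integral_mono i1 ((hcut Q hQc).add i2) hDf).trans ?_
    change ∫ x, (φ x * Q x + (closedBall 0 2).indicator (fun x => (1 + M₁) * (1 + u x)) x) ≤ _
    rw [integral_add (hcut Q hQc) i2, integral_indicator measurableSet_closedBall,
      integral_const_mul]
    have : (1 + M₁) * ∫ x in closedBall 0 2, (1 + u x) ≤ (1 + M₁) * (V + M) := by gcongr
    linarith
  have hfp : Continuous fun x => f x ^ p := hf1.continuous.rpow_const fun _ => Or.inr hp0.le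
  have hfpi : Integrable fun x => f x ^ p := hfp.integrable_of_hasCompactSupport
    (hfc.comp_left (g := fun s : ℝ => s ^ p) (Real.zero_rpow hp0.ne'))
  have hIf : ∫ x, f x ^ p ≤ B₃ := by
    have hsob := lintegral_pow_le_pow_lintegral_fderiv
      (volume : Measure (EuclideanSpace ℝ (Fin N))) hf1 hfc (p := p) (by
        rw [finrank_euclideanSpace_fin]
        exact Real.HolderConjugate.conjExponent (by linarith))
    have e1 : ∫⁻ x, ‖fderiv ℝ f x‖ₑ ≤ ENNReal.ofReal B₂ := by
      rw [← ofReal_integral_norm_eq_lintegral_enorm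
        ((hf1.continuous_fderiv (by norm_num)).integrable_of_hasCompactSupport (hfc.fderiv ℝ))]
      exact ENNReal.ofReal_le_ofReal hIDf
    have e2 : ENNReal.ofReal (∫ x, f x ^ p) = ∫⁻ x, ‖f x‖ₑ ^ p := by
      rw [ofReal_integral_eq_lintegral_ofReal hfpi
        (ae_of_all _ fun x => Real.rpow_nonneg (hf0 x) _)]
      refine lintegral_congr fun x => ?_
      rw [← ENNReal.ofReal_rpow_of_nonneg (hf0 x) hp0.le, Real.enorm_of_nonneg (hf0 x)]
    rw [hB₃, ← ENNReal.ofReal_le_iff_le_toReal, e2]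
    · refine hsob.trans ?_
      gcongr
    · exact ENNReal.mul_ne_top ENNReal.coe_ne_top
        (ENNReal.rpow_ne_top_of_nonneg hp0.le ENNReal.ofReal_ne_top)
  have hle : ∀ x, 1 / 2 < ‖x‖ ∧ ‖x‖ < 1 → ‖gradient u x‖ ≤ φ x * Q x + f x ^ p := by
    intro x hx
    have hfx : f x ^ p = (1 + u x) ^ (2 - γ) := by
      simp only [hf, hz]
      rw [hφ1 x hx.1.le hx.2.le, one_mul, ← Real.rpow_mul (hw0 x).le, hγp]
    rw [norm_gradient, hφ1 x hx.1.le hx.2.le, one_mul, hfx]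
    have e : 0 < (1 + u x) ^ (2 - γ) := Real.rpow_pos_of_pos (hw0 x) _
    have e' : (1 + u x) ^ (γ - 2) = ((1 + u x) ^ (2 - γ))⁻¹ := by
      rw [← Real.rpow_neg (hw0 x).le, neg_sub]
    change d x ≤ (1 + u x) ^ (γ - 2) * d x ^ 2 + _
    rw [e', ← sub_nonneg]
    have : ((1 + u x) ^ (2 - γ))⁻¹ * d x ^ 2 + (1 + u x) ^ (2 - γ) - d x =
        ((1 + u x) ^ (2 - γ))⁻¹ * (d x ^ 2 + ((1 + u x) ^ (2 - γ)) ^ 2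
          - d x * (1 + u x) ^ (2 - γ)) := by
      field_simp
    rw [this]
    refine mul_nonneg (inv_nonneg.2 e.le) ?_
    nlinarith [sq_nonneg (d x - (1 + u x) ^ (2 - γ)), norm_nonneg (fderiv ℝ u x), sq_nonneg (d x),
      sq_nonneg ((1 + u x) ^ (2 - γ))]
  have hgi : IntegrableOn (fun x => ‖gradient u x‖) {x | 1 / 2 < ‖x‖ ∧ ‖x‖ < 1} := by
    simp_rw [norm_gradient]
    exact integrableOn_annulus hdc
  have hsum : Integrable fun x => φ x * Q x + f x ^ p := (hcut Q hQc).add hfpi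
  calc ∫ x in {x | 1 / 2 < ‖x‖ ∧ ‖x‖ < 1}, ‖gradient u x‖
      ≤ ∫ x in {x | 1 / 2 < ‖x‖ ∧ ‖x‖ < 1}, (φ x * Q x + f x ^ p) :=
        setIntegral_mono_on hgi hsum.integrableOn (measurableSet_annulus _ _) hle
    _ ≤ ∫ x, (φ x * Q x + f x ^ p) := setIntegral_le_integral hsum (ae_of_all _ fun x =>
        add_nonneg (mul_nonneg (hφ0 x) (hQ0 x)) (Real.rpow_nonneg (hf0 x) _))
    _ = (∫ x, φ x * Q x) + ∫ x, f x ^ p := integral_add (hcut Q hQc) hfpi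
    _ ≤ B₁ + B₃ := add_le_add hIQ hIf

end Annulus

section Solution

variable {N : ℕ} {a b p q s t R : ℝ} {u v : EuclideanSpace ℝ (Fin N) → ℝ}

lemma IsHHSol.symm {Ω : Set (EuclideanSpace ℝ (Fin N))} (h : IsHHSol a b p q Ω u v) :
    IsHHSol b a q p Ω v u :=
  ⟨h.2.1, h.1, h.2.2.2.1, h.2.2.1, h.2.2.2.2.2.1, h.2.2.2.2.1, h.2.2.2.2.2.2.2, h.2.2.2.2.2.2.1⟩

lemma IsHHSol.continuous (h : IsHHSol a b p q univ u v) : Continuous u :=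
  continuousOn_univ.1 h.1

lemma IsHHSol.contDiffOn (h : IsHHSol a b p q univ u v) : ContDiffOn ℝ 2 u {0}ᶜ := by
  rw [compl_eq_univ_sdiff]
  exact h.2.2.1

lemma IsHHSol.pos (h : IsHHSol a b p q univ u v) (x : EuclideanSpace ℝ (Fin N)) : 0 < u x :=
  h.2.2.2.2.1 x (mem_univ x)

lemma IsHHSol.neg_lap_eq (h : IsHHSol a b p q univ u v) {x : EuclideanSpace ℝ (Fin N)}
    (hx : x ≠ 0) : -lap u x = ‖x‖ ^ a * v x ^ p :=
  h.2.2.2.2.2.2.1 x ⟨mem_univ x, hx⟩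

lemma IsHHSol.lap_nonpos (h : IsHHSol a b p q univ u v) (x : EuclideanSpace ℝ (Fin N))
    (hx : x ≠ 0) : lap u x ≤ 0 := by
  have h1 := h.neg_lap_eq hx
  have h2 : 0 ≤ ‖x‖ ^ a * v x ^ p :=
    mul_nonneg (Real.rpow_nonneg (norm_nonneg x) _) (Real.rpow_nonneg (h.symm.pos x).le _)
  linarith

lemma IsHHSol.setIntegral_closedBall_pos (h : IsHHSol a b p q univ u v) :
    0 < ∫ x in closedBall 0 2, u x := by
  rw [setIntegral_pos_iff_support_of_nonneg_ae (ae_of_all _ fun x => (h.pos x).le)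
    (integrableOn_closedBall h.continuous 2)]
  have : Function.support u = univ := eq_univ_of_forall fun x => (h.pos x).ne'
  rw [this, univ_inter]
  exact measure_closedBall_pos _ _ (by norm_num)

lemma measureReal_annulus_pos (hN : 3 ≤ N) :
    0 < volume.real {x : EuclideanSpace ℝ (Fin N) | 1 / 2 < ‖x‖ ∧ ‖x‖ < 1} := by
  have : Nonempty (Fin N) := ⟨⟨0, by omega⟩⟩
  refine ENNReal.toReal_pos ?_ ?_
  · refine (IsOpen.measure_pos _ ?_ ?_).ne'
    · exact (isOpen_lt continuous_const continuous_norm).inter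
        (isOpen_lt continuous_norm continuous_const)
    · obtain ⟨x, hx⟩ := exists_norm_eq (EuclideanSpace ℝ (Fin N)) (c := 3 / 4) (by norm_num)
      exact ⟨x, by rw [mem_ofPred_eq, hx]; norm_num⟩
  · refine ((measure_mono fun x hx => ?_).trans_lt
      (measure_closedBall_lt_top (x := (0 : EuclideanSpace ℝ (Fin N))) (r := 1))).ne
    exact mem_closedBall_zero_iff.2 hx.2.le

lemma min_rpow_le {r : ℝ} (h1 : 1 / 2 < r) (h2 : r < 1) (a : ℝ) :
    min 1 ((1 / 2 : ℝ) ^ a) ≤ r ^ a := by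
  rcases le_total 0 a with ha | ha
  · exact (min_le_right _ _).trans (Real.rpow_le_rpow (by norm_num) h1.le ha)
  · exact (min_le_left _ _).trans
      (Real.one_le_rpow_of_pos_of_le_one_of_nonpos (by linarith) h2.le ha)

lemma exists_rpow_setIntegral_le (hN : 3 ≤ N) (a b : ℝ) (hp : 0 < p) (q : ℝ) :
    ∃ K > 0, ∀ u v : EuclideanSpace ℝ (Fin N) → ℝ, IsHHSol a b p q univ u v →
      (∫ x in closedBall 0 2, v x) ^ p ≤ K * ∫ x in closedBall 0 2, u x := by
  obtain ⟨c, hc, hH⟩ := exists_mul_integral_le hN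
  obtain ⟨C, hC, hE⟩ := exists_integral_annulus_abs_lap_le N
  set m := min 1 ((1 / 2 : ℝ) ^ a)
  have hm : 0 < m := lt_min one_pos (Real.rpow_pos_of_pos (by norm_num) _)
  set V := volume.real {x : EuclideanSpace ℝ (Fin N) | 1 / 2 < ‖x‖ ∧ ‖x‖ < 1}
  have hV : 0 < V := measureReal_annulus_pos hN
  have hcp : 0 < c ^ p := Real.rpow_pos_of_pos hc p
  refine ⟨C / (V * (m * c ^ p)), by positivity, fun u v h => ?_⟩
  have hJ := h.symm.setIntegral_closedBall_pos
  set J := ∫ x in closedBall 0 2, v x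
  have h1 := hE u h.continuous h.contDiffOn h.pos h.lap_nonpos
  have h2 : V * (m * (c * J) ^ p) ≤ ∫ x in {x | 1 / 2 < ‖x‖ ∧ ‖x‖ < 1}, |lap u x| := by
    rw [← smul_eq_mul, ← setIntegral_const]
    refine setIntegral_mono_on (integrableOn_annulus continuousOn_const)
      (integrableOn_annulus (continuousOn_lap h.contDiffOn).abs) (measurableSet_annulus _ _)
      fun x hx => ?_
    have hx0 : x ≠ 0 := by
      rintro rfl
      have := hx.1
      norm_num at this
    have hcJ : c * J ≤ v x := hH v h.symm.continuous h.symm.contDiffOn h.symm.pos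
      h.symm.lap_nonpos x (mem_closedBall_zero_iff.2 (by linarith [hx.2]))
    rw [abs_of_nonpos (h.lap_nonpos x hx0), h.neg_lap_eq hx0]
    have := min_rpow_le hx.1 hx.2 a
    gcongr
  rw [Real.mul_rpow hc.le hJ.le] at h2
  rw [div_mul_eq_mul_div, le_div_iff₀ (by positivity)]
  calc J ^ p * (V * (m * c ^ p)) = V * (m * (c ^ p * J ^ p)) := by ring
    _ ≤ _ := h2.trans h1

lemma le_rpow_of_rpow_le_mul {K L I J : ℝ} (hp : 0 < p) (hpq : 1 < p * q)
    (hL : 0 < L) (hI : 0 < I) (hJ : 0 < J) (h1 : J ^ p ≤ K * I)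
    (h2 : I ^ q ≤ L * J) : I ≤ (L ^ p * K) ^ (p * q - 1)⁻¹ := by
  have h3 : I ^ (p * q - 1) * I ≤ L ^ p * K * I := by
    calc I ^ (p * q - 1) * I = (I ^ q) ^ p := by
          rw [← Real.rpow_add_one hI.ne', sub_add_cancel, ← Real.rpow_mul hI.le, mul_comm]
      _ ≤ (L * J) ^ p := Real.rpow_le_rpow (Real.rpow_nonneg hI.le _) h2 hp.le
      _ = L ^ p * J ^ p := Real.mul_rpow hL.le hJ.le
      _ ≤ L ^ p * (K * I) := mul_le_mul_of_nonneg_left h1 (Real.rpow_nonneg hL.le _)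
      _ = L ^ p * K * I := by ring
  have h4 := le_of_mul_le_mul_right h3 hI
  have h5 : 0 < p * q - 1 := by linarith
  calc I = (I ^ (p * q - 1)) ^ (p * q - 1)⁻¹ := by
        rw [← Real.rpow_mul hI.le, mul_inv_cancel₀ h5.ne', Real.rpow_one]
    _ ≤ _ := Real.rpow_le_rpow (Real.rpow_nonneg hI.le _) h4 (inv_nonneg.2 h5.le)

lemma exists_annulus_estimates (hN : 3 ≤ N) (a b : ℝ) (hp : 0 < p) (hq : 0 < q)
    (hpq : 1 < p * q) :
    ∃ C > 0, ∀ u v : EuclideanSpace ℝ (Fin N) → ℝ, IsHHSol a b p q univ u v →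
      ∫ x in {x | 1 / 2 < ‖x‖ ∧ ‖x‖ < 1}, u x ≤ C ∧
      ∫ x in {x | 1 / 2 < ‖x‖ ∧ ‖x‖ < 1}, ‖gradient u x‖ ≤ C ∧
      ∫ x in {x | 1 / 2 < ‖x‖ ∧ ‖x‖ < 1}, |lap u x| ≤ C := by
  obtain ⟨K, hK, hKle⟩ := exists_rpow_setIntegral_le hN a b hp q
  obtain ⟨L, hL, hLle⟩ := exists_rpow_setIntegral_le hN b a hq p
  set M := (L ^ p * K) ^ (p * q - 1)⁻¹
  have hM : 0 < M := by positivity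
  obtain ⟨C₁, hC₁, h₁⟩ := exists_integral_annulus_abs_lap_le N
  obtain ⟨C₂, h₂⟩ := exists_integral_annulus_gradient_le hN M
  refine ⟨M + |C₂| + C₁ * M, by positivity, fun u v h => ?_⟩
  have hI : ∫ x in closedBall 0 2, u x ≤ M :=
    le_rpow_of_rpow_le_mul hp hpq hL h.setIntegral_closedBall_pos
      h.symm.setIntegral_closedBall_pos (hKle u v h) (hLle v u h.symm)
  have hC₁M : 0 < C₁ * M := by positivity
  refine ⟨?_, ?_, ?_⟩
  · have : ∫ x in {x | 1 / 2 < ‖x‖ ∧ ‖x‖ < 1}, u x ≤ ∫ x in closedBall 0 2, u x :=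
      setIntegral_mono_set (integrableOn_closedBall h.continuous 2)
        (ae_of_all _ fun x => (h.pos x).le)
        (LE.le.eventuallyLE fun x hx =>
          mem_closedBall_zero_iff.2 (by linarith [hx.2]))
    linarith [abs_nonneg C₂]
  · have := h₂ u h.continuous h.contDiffOn h.pos h.lap_nonpos hI
    linarith [le_abs_self C₂]
  · have := h₁ u h.continuous h.contDiffOn h.pos h.lap_nonpos
    have := mul_le_mul_of_nonneg_left hI hC₁.le
    linarith [abs_nonneg C₂]

end Solution

section Scaling

variable {N : ℕ} {a b p q s t R : ℝ} {u v : EuclideanSpace ℝ (Fin N) → ℝ}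

lemma contDiffAt_comp_smul (hu : ContDiffOn ℝ 2 u {0}ᶜ) (hR : 0 < R)
    {y : EuclideanSpace ℝ (Fin N)} (hy : y ≠ 0) :
    ContDiffAt ℝ 2 (fun y => u (R • y)) y := by
  have h := contDiffAt_comp_affine (f := u) (x := y) R 0 (by
    rw [add_zero]
    exact contDiffAt_of_punctured hu (smul_ne_zero hR.ne' hy))
  simpa using h

lemma lap_rpow_mul_comp_smul (s : ℝ) (hu : ContDiffOn ℝ 2 u {0}ᶜ) (hR : 0 < R)
    {y : EuclideanSpace ℝ (Fin N)} (hy : y ≠ 0) :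
    lap (fun y => R ^ s * u (R • y)) y = R ^ (s + 2) * lap u (R • y) := by
  have h := lap_comp_affine (f := u) (x := y) R 0 (by
    rw [add_zero]
    exact contDiffAt_of_punctured hu (smul_ne_zero hR.ne' hy))
  simp only [add_zero] at h
  rw [lap_const_mul _ (contDiffAt_comp_smul hu hR hy), h, Real.rpow_add hR, Real.rpow_two,
    mul_assoc]

lemma norm_gradient_rpow_mul_comp_smul (s : ℝ) (hu : ContDiffOn ℝ 2 u {0}ᶜ) (hR : 0 < R)
    {y : EuclideanSpace ℝ (Fin N)} (hy : y ≠ 0) :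
    ‖gradient (fun y => R ^ s * u (R • y)) y‖ = R ^ (s + 1) * ‖gradient u (R • y)‖ := by
  have h := fderiv_comp_affine (f := u) (x := y) R 0 (by
    rw [add_zero]
    exact (contDiffAt_of_punctured hu (smul_ne_zero hR.ne' hy)).differentiableAt (by norm_num))
  simp only [add_zero] at h
  rw [norm_gradient, norm_gradient, fderiv_const_mul
    ((contDiffAt_comp_smul hu hR hy).differentiableAt (by norm_num)), h, norm_smul, norm_smul,
    Real.norm_of_nonneg (Real.rpow_nonneg hR.le _), Real.norm_of_nonneg hR.le,
    Real.rpow_add_one hR.ne', mul_assoc]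

lemma IsHHSol.rpow_mul_comp_smul (h : IsHHSol a b p q univ u v) (hs : s + 2 + a = p * t)
    (ht : t + 2 + b = q * s) (hR : 0 < R) :
    IsHHSol a b p q univ (fun y => R ^ s * u (R • y)) (fun y => R ^ t * v (R • y)) := by
  have hcont : ∀ (w : EuclideanSpace ℝ (Fin N) → ℝ) (c : ℝ), Continuous w →
      Continuous fun y => R ^ c * w (R • y) := fun w c hw =>
    continuous_const.mul (hw.comp (continuous_const_smul R))
  have hdiff : ∀ (w : EuclideanSpace ℝ (Fin N) → ℝ) (c : ℝ), ContDiffOn ℝ 2 w {0}ᶜ →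
      ContDiffOn ℝ 2 (fun y => R ^ c * w (R • y)) (univ \ {0}) := fun w c hw y hy =>
    (contDiffAt_const.mul (contDiffAt_comp_smul hw hR hy.2)).contDiffWithinAt
  have heq : ∀ {a b p q s t : ℝ} {u v : EuclideanSpace ℝ (Fin N) → ℝ},
      IsHHSol a b p q univ u v → s + 2 + a = p * t → ∀ y ∈ univ \ {0},
      -lap (fun y => R ^ s * u (R • y)) y = ‖y‖ ^ a * (R ^ t * v (R • y)) ^ p := by
    intro a b p q s t u v h hs y hy
    rw [lap_rpow_mul_comp_smul s h.contDiffOn hR hy.2, ← mul_neg,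
      h.neg_lap_eq (smul_ne_zero hR.ne' hy.2), norm_smul, Real.norm_of_nonneg hR.le,
      Real.mul_rpow hR.le (norm_nonneg y),
      Real.mul_rpow (Real.rpow_nonneg hR.le _) (h.symm.pos _).le, ← Real.rpow_mul hR.le,
      mul_comm t p, ← hs, Real.rpow_add hR (s + 2) a]
    ring
  exact ⟨(hcont u s h.continuous).continuousOn, (hcont v t h.symm.continuous).continuousOn,
    hdiff u s h.contDiffOn, hdiff v t h.symm.contDiffOn,
    fun y _ => mul_pos (Real.rpow_pos_of_pos hR _) (h.pos _),
    fun y _ => mul_pos (Real.rpow_pos_of_pos hR _) (h.symm.pos _), heq h hs, heq h.symm ht⟩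

open Pointwise in
lemma setIntegral_annulus_le_of_comp_smul {F G : EuclideanSpace ℝ (Fin N) → ℝ} {C : ℝ}
    (hR : 0 < R) (hFG : ∀ y ≠ 0, G y = R ^ s * F (R • y))
    (hG : ∫ y in {y | 1 / 2 < ‖y‖ ∧ ‖y‖ < 1}, G y ≤ C) :
    ∫ x in {x | R / 2 < ‖x‖ ∧ ‖x‖ < R}, F x ≤ C * R ^ (N - s : ℝ) := by
  have h1 : ∫ y in {y | 1 / 2 < ‖y‖ ∧ ‖y‖ < 1}, G y =
      R ^ s * ∫ y in {y | 1 / 2 < ‖y‖ ∧ ‖y‖ < 1}, F (R • y) := by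
    rw [← integral_const_mul]
    refine setIntegral_congr_fun (measurableSet_annulus _ _) fun y hy => hFG y ?_
    rintro rfl
    have := hy.1
    norm_num at this
  have h2 : R • {y : EuclideanSpace ℝ (Fin N) | 1 / 2 < ‖y‖ ∧ ‖y‖ < 1} =
      {x | R / 2 < ‖x‖ ∧ ‖x‖ < R} := by
    ext x
    rw [mem_smul_set_iff_inv_smul_mem₀ hR.ne', mem_ofPred_eq, mem_ofPred_eq, norm_smul, norm_inv,
      Real.norm_of_nonneg hR.le, ← div_eq_inv_mul, lt_div_iff₀ hR, div_lt_one hR,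
      one_div_mul_eq_div]
  rw [h1, Measure.setIntegral_comp_smul_of_pos _ _ _ hR, h2, finrank_euclideanSpace_fin,
    smul_eq_mul] at hG
  calc ∫ x in {x | R / 2 < ‖x‖ ∧ ‖x‖ < R}, F x
      = R ^ s * ((R ^ N)⁻¹ * ∫ x in {x | R / 2 < ‖x‖ ∧ ‖x‖ < R}, F x) * R ^ (N - s : ℝ) := by
        have h3 : R ^ s ≠ 0 := (Real.rpow_pos_of_pos hR s).ne'
        rw [Real.rpow_sub hR, Real.rpow_natCast]
        field_simp
    _ ≤ C * R ^ (N - s : ℝ) := mul_le_mul_of_nonneg_right hG (Real.rpow_nonneg hR.le _)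

lemma exists_annulus_estimates_rpow (hN : 3 ≤ N) (hp : 0 < p) (hq : 0 < q) (hpq : 1 < p * q)
    (hs : s + 2 + a = p * t) (ht : t + 2 + b = q * s) :
    ∃ C > 0, ∀ u v : EuclideanSpace ℝ (Fin N) → ℝ, IsHHSol a b p q univ u v → ∀ R > 0,
      ∫ x in {x | R / 2 < ‖x‖ ∧ ‖x‖ < R}, u x ≤ C * R ^ (N - s) ∧
      ∫ x in {x | R / 2 < ‖x‖ ∧ ‖x‖ < R}, ‖gradient u x‖ ≤ C * R ^ (N - (s + 1)) ∧
      ∫ x in {x | R / 2 < ‖x‖ ∧ ‖x‖ < R}, |lap u x| ≤ C * R ^ (N - (s + 2)) := by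
  obtain ⟨C, hC, h⟩ := exists_annulus_estimates hN a b hp hq hpq
  refine ⟨C, hC, fun u v huv R hR => ?_⟩
  obtain ⟨h1, h2, h3⟩ := h _ _ (huv.rpow_mul_comp_smul hs ht hR)
  refine ⟨setIntegral_annulus_le_of_comp_smul hR (fun y _ => rfl) h1,
    setIntegral_annulus_le_of_comp_smul hR
      (fun y hy => norm_gradient_rpow_mul_comp_smul s huv.contDiffOn hR hy) h2,
    setIntegral_annulus_le_of_comp_smul (F := fun x => |lap u x|) hR (fun y hy => ?_) h3⟩
  rw [lap_rpow_mul_comp_smul s huv.contDiffOn hR hy, abs_mul,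
    abs_of_pos (Real.rpow_pos_of_pos hR _)]

end Scaling

/-- Lemma 2.5: integral estimates on annuli for `u`, `v`, their gradients and their
Laplacians, for positive solutions of the Hardy–Hénon system on `ℝ^N`. -/
theorem integral_estimates
    (N : ℕ) (hN : 3 ≤ N) (a b p q : ℝ) (ha : -2 < a) (hb : -2 < b)
    (hp : 0 < p) (hq : 0 < q) (hpq : 1 < p * q) :
    ∃ C > 0, ∀ u v : EuclideanSpace ℝ (Fin N) → ℝ,
      IsHHSol a b p q (univ : Set (EuclideanSpace ℝ (Fin N))) u v →
      ∀ R > (0 : ℝ),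
        (∫ x in {x : EuclideanSpace ℝ (Fin N) | R / 2 < ‖x‖ ∧ ‖x‖ < R}, u x)
          ≤ C * R ^ ((N : ℝ) - 2 * (p + 1) / (p * q - 1) - (a + b * p) / (p * q - 1)) ∧
        (∫ x in {x : EuclideanSpace ℝ (Fin N) | R / 2 < ‖x‖ ∧ ‖x‖ < R}, v x)
          ≤ C * R ^ ((N : ℝ) - 2 * (q + 1) / (p * q - 1) - (b + a * q) / (p * q - 1)) ∧
        (∫ x in {x : EuclideanSpace ℝ (Fin N) | R / 2 < ‖x‖ ∧ ‖x‖ < R}, ‖gradient u x‖)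
          ≤ C * R ^ ((N : ℝ) - 1 - 2 * (p + 1) / (p * q - 1) - (a + b * p) / (p * q - 1)) ∧
        (∫ x in {x : EuclideanSpace ℝ (Fin N) | R / 2 < ‖x‖ ∧ ‖x‖ < R}, ‖gradient v x‖)
          ≤ C * R ^ ((N : ℝ) - 1 - 2 * (q + 1) / (p * q - 1) - (b + a * q) / (p * q - 1)) ∧
        (∫ x in {x : EuclideanSpace ℝ (Fin N) | R / 2 < ‖x‖ ∧ ‖x‖ < R}, |lap u x|)
          ≤ C * R ^ ((N : ℝ) - 2 - 2 * (p + 1) / (p * q - 1) - (a + b * p) / (p * q - 1)) ∧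
        (∫ x in {x : EuclideanSpace ℝ (Fin N) | R / 2 < ‖x‖ ∧ ‖x‖ < R}, |lap v x|)
          ≤ C * R ^ ((N : ℝ) - 2 - 2 * (q + 1) / (p * q - 1) - (b + a * q) / (p * q - 1)) := by
  have hpq' : p * q - 1 ≠ 0 := by linarith
  have hqp : 1 < q * p := by rwa [mul_comm]
  have hqp' : q * p - 1 ≠ 0 := by linarith
  set s := 2 * (p + 1) / (p * q - 1) + (a + b * p) / (p * q - 1) with hs
  set t := 2 * (q + 1) / (p * q - 1) + (b + a * q) / (p * q - 1) with ht
  have hst : s + 2 + a = p * t := by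
    rw [hs, ht]
    field_simp
    ring
  have hts : t + 2 + b = q * s := by
    rw [hs, ht]
    field_simp
    ring
  obtain ⟨C₁, hC₁, h₁⟩ := exists_annulus_estimates_rpow hN hp hq hpq hst hts
  obtain ⟨C₂, hC₂, h₂⟩ := exists_annulus_estimates_rpow hN hq hp hqp hts hst
  refine ⟨C₁ + C₂, by positivity, fun u v huv R hR => ?_⟩
  obtain ⟨u₁, u₂, u₃⟩ := h₁ u v huv R hR
  obtain ⟨v₁, v₂, v₃⟩ := h₂ v u huv.symm R hR
  have hle : ∀ {I C e e' : ℝ}, I ≤ C * R ^ e → C ≤ C₁ + C₂ → e = e' →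
      I ≤ (C₁ + C₂) * R ^ e' := by
    rintro I C e _ hI hC rfl
    exact hI.trans (mul_le_mul_of_nonneg_right hC (Real.rpow_nonneg hR.le _))
  have hCu : C₁ ≤ C₁ + C₂ := by linarith
  have hCv : C₂ ≤ C₁ + C₂ := by linarith
  exact ⟨hle u₁ hCu (by ring), hle v₁ hCv (by ring), hle u₂ hCu (by ring), hle v₂ hCv (by ring),
    hle u₃ hCu (by ring), hle v₃ hCv (by ring)⟩
end
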